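/- arXiv:1701.07721 — 4 statements merged into one kernel-verified Lean document; each statement's English description precedes it below -/
import Mathlib

section
/- Let R be a commutative noetherian ring with unity, let a be an ideal of R, and let M be an R-module. Then Ext^i_R(R/a, M) is a finitely generated R-module for every i ≥ 0 if and only if Tor^R_i(R/a, M) is a finitely generated R-module for every i ≥ 0. -/
open CategoryTheory

instance homologyFunctor_linear {R C : Type*} [Ring R] [Category* C] [Preadditive C] [Linear R C]
    [CategoryWithHomology C] {ι : Type*} (c : ComplexShape ι) (i : ι) :
    (HomologicalComplex.homologyFunctor C c i).Linear R where
  map_smul f r := ShortComplex.homologyMap_smul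
      ((HomologicalComplex.shortComplexFunctor C c i).map f) r

instance homotopyCategory_homologyFunctor_linear {R C : Type*} [Ring R] [Category* C]
    [Preadditive C] [Linear R C]
    [CategoryWithHomology C] {ι : Type*} (c : ComplexShape ι) (i : ι) :
    (HomotopyCategory.homologyFunctor C c i).Linear R :=
  have := Functor.linear_of_iso R (HomotopyCategory.homologyFunctorFactors C c i).symm
  (HomotopyCategory.quotient C c).linear_of_full_essSurj_comp _

noncomputable abbrev cohomologyOf {R : Type u} [CommRing R]
    (F : ModuleCat.{u} R ⥤ ModuleCat.{u} R) [F.Additive]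
    (J : CochainComplex (ModuleCat.{u} R) ℤ) (i : ℤ) : ModuleCat.{u} R :=
  ((F.mapHomologicalComplex _).obj J).homology i

noncomputable abbrev smulCone {R : Type u} [CommRing R] (x : R)
    (J : CochainComplex (ModuleCat.{u} R) ℤ) : CochainComplex (ModuleCat.{u} R) ℤ :=
  CochainComplex.mappingCone (x • 𝟙 J)

theorem exists_exact_of_distinguished {R C : Type*} [CommRing R] [Category* C] [Preadditive C]
    [Limits.HasZeroObject C] [HasShift C ℤ] [∀ n : ℤ, (shiftFunctor C n).Additive]
    [Pretriangulated C] [Linear R C]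
    (H : C ⥤ ModuleCat.{u} R) [H.IsHomological] [H.ShiftSequence ℤ] [∀ n : ℤ, (H.shift n).Linear R]
    (x : R) {X Y : C} (f : X ⟶ Y) (g : Y ⟶ X⟦(1 : ℤ)⟧)
    (hT : Pretriangulated.Triangle.mk (x • 𝟙 X) f g ∈ Pretriangulated.distinguishedTriangles)
    (i j : ℤ) (h : i + 1 = j) :
    ∃ (φ : (H.shift i).obj X →ₗ[R] (H.shift i).obj Y)
      (δ : (H.shift i).obj Y →ₗ[R] (H.shift j).obj X),
      Function.Exact (fun y : (H.shift i).obj X => x • y) φ ∧ Function.Exact φ δ ∧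
      Function.Exact δ (fun y : (H.shift j).obj X => x • y) := by
  have e1 := H.homologySequence_exact₁ _ hT i j h
  have e2 := H.homologySequence_exact₂ _ hT i
  have e3 := H.homologySequence_exact₃ _ hT i j h
  rw [ShortComplex.ShortExact.moduleCat_exact_iff_function_exact] at e1 e2 e3
  have key (k : ℤ) : (fun y : (H.shift k).obj X => x • y) =
      ((H.shift k).map (x • 𝟙 X)).hom := by
    rw [Functor.map_smul, CategoryTheory.Functor.map_id]; rfl
  refine ⟨((H.shift i).map f).hom,
    (H.homologySequenceδ (Pretriangulated.Triangle.mk (x • 𝟙 X) f g) i j h).hom, ?_, e3, ?_⟩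
  · rw [key]; exact e2
  · rw [key]; exact e1

noncomputable def cohomologyOfEquiv {R : Type u} [CommRing R]
    (F : ModuleCat.{u} R ⥤ ModuleCat.{u} R) [F.Additive]
    (J : CochainComplex (ModuleCat.{u} R) ℤ) (i : ℤ) :
    ((F.mapHomotopyCategory (.up ℤ) ⋙
      HomotopyCategory.homologyFunctor (ModuleCat.{u} R) (.up ℤ) i).obj
      ((HomotopyCategory.quotient _ _).obj J)) ≃ₗ[R] cohomologyOf F J i :=
  ((HomotopyCategory.homologyFunctorFactors (ModuleCat.{u} R) (.up ℤ) i).app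
    ((F.mapHomologicalComplex _).obj J)).toLinearEquiv

theorem exists_exact_of_distinguished_map {R C D : Type*} [CommRing R] [Category* C] [Preadditive C]
    [Limits.HasZeroObject C] [HasShift C ℤ] [∀ n : ℤ, (shiftFunctor C n).Additive]
    [Pretriangulated C] [Linear R C] [Category* D] [Preadditive D]
    [Limits.HasZeroObject D] [HasShift D ℤ] [∀ n : ℤ, (shiftFunctor D n).Additive]
    [Pretriangulated D] [Linear R D] (G : D ⥤ C) [G.CommShift ℤ] [G.IsTriangulated] [G.Additive]
    [G.Linear R]
    (H : C ⥤ ModuleCat.{u} R) [H.IsHomological] [H.ShiftSequence ℤ] [∀ n : ℤ, (H.shift n).Linear R]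
    (x : R) {X Y : D} (f : X ⟶ Y) (g : Y ⟶ X⟦(1 : ℤ)⟧)
    (hT : Pretriangulated.Triangle.mk (x • 𝟙 X) f g ∈ Pretriangulated.distinguishedTriangles)
    (i j : ℤ) (h : i + 1 = j) :
    ∃ (φ : (H.shift i).obj (G.obj X) →ₗ[R] (H.shift i).obj (G.obj Y))
      (δ : (H.shift i).obj (G.obj Y) →ₗ[R] (H.shift j).obj (G.obj X)),
      Function.Exact (fun y : (H.shift i).obj (G.obj X) => x • y) φ ∧ Function.Exact φ δ ∧
      Function.Exact δ (fun y : (H.shift j).obj (G.obj X) => x • y) := by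
  have hG : Pretriangulated.Triangle.mk (G.map (x • 𝟙 X)) (G.map f)
      (G.map g ≫ (G.commShiftIso (1 : ℤ)).hom.app X) ∈ Pretriangulated.distinguishedTriangles :=
    G.map_distinguished _ hT
  rw [Functor.map_smul, CategoryTheory.Functor.map_id] at hG
  exact exists_exact_of_distinguished H x _ _ hG i j h

theorem exists_exact_conj {R : Type*} [CommRing R] (x : R) {A B D A' B' D' : Type*}
   [AddCommGroup A] [Module R A] [AddCommGroup B] [Module R B] [AddCommGroup D] [Module R D]
   [AddCommGroup A'] [Module R A'] [AddCommGroup B'] [Module R B'] [AddCommGroup D'] [Module R D']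
   (eA : A ≃ₗ[R] A') (eB : B ≃ₗ[R] B') (eD : D ≃ₗ[R] D')
   (h : ∃ (φ : A →ₗ[R] B) (δ : B →ₗ[R] D), Function.Exact (fun y : A => x • y) φ ∧
      Function.Exact φ δ ∧ Function.Exact δ (fun y : D => x • y)) :
   ∃ (φ : A' →ₗ[R] B') (δ : B' →ₗ[R] D'), Function.Exact (fun y : A' => x • y) φ ∧
      Function.Exact φ δ ∧ Function.Exact δ (fun y : D' => x • y) := by
  obtain ⟨φ, δ, h1, h2, h3⟩ := h
  refine ⟨eB.toLinearMap ∘ₗ φ ∘ₗ eA.symm.toLinearMap,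
    eD.toLinearMap ∘ₗ δ ∘ₗ eB.symm.toLinearMap, fun y => ?_, fun y => ?_, fun y => ?_⟩
  · have := h1 (eA.symm y)
    simp only [Set.mem_range] at this
    simp only [LinearMap.comp_apply, LinearEquiv.coe_coe, EmbeddingLike.map_eq_zero_iff, this,
      Set.mem_range]
    exact ⟨fun ⟨z, hz⟩ => ⟨eA z, by rw [← map_smul, hz]; simp⟩,
      fun ⟨z, hz⟩ => ⟨eA.symm z, by rw [← map_smul, hz]⟩⟩
  · have := h2 (eB.symm y)
    simp only [Set.mem_range] at this
    simp only [LinearMap.comp_apply, LinearEquiv.coe_coe, EmbeddingLike.map_eq_zero_iff, this,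
      Set.mem_range]
    exact ⟨fun ⟨z, hz⟩ => ⟨eA z, by simp [hz]⟩,
      fun ⟨z, hz⟩ => ⟨eA.symm z, by rw [← hz]; simp⟩⟩
  · have := h3 (eD.symm y)
    simp only [Set.mem_range, ← map_smul, EmbeddingLike.map_eq_zero_iff] at this
    simp only [LinearMap.comp_apply, LinearEquiv.coe_coe, this, Set.mem_range]
    exact ⟨fun ⟨z, hz⟩ => ⟨eB z, by simp [hz]⟩,
      fun ⟨z, hz⟩ => ⟨eB.symm z, by rw [← hz]; simp⟩⟩

theorem exists_smulCone_exact {R : Type u} [CommRing R]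
    (F : ModuleCat.{u} R ⥤ ModuleCat.{u} R) [F.Additive] [F.Linear R] (x : R)
    (J : CochainComplex (ModuleCat.{u} R) ℤ) (i j : ℤ) (h : i + 1 = j) :
    ∃ (g : cohomologyOf F J i →ₗ[R] cohomologyOf F (smulCone x J) i)
      (δ : cohomologyOf F (smulCone x J) i →ₗ[R] cohomologyOf F J j),
      Function.Exact (fun y : cohomologyOf F J i => x • y) g ∧ Function.Exact g δ ∧
      Function.Exact δ (fun y : cohomologyOf F J j => x • y) := by
  have := fun n => homotopyCategory_homologyFunctor_linear (R := R) (C := ModuleCat.{u} R) (.up ℤ) n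
  let H := HomotopyCategory.homologyFunctor (ModuleCat.{u} R) (.up ℤ) 0
  have : ∀ n : ℤ, (H.shift n).Linear R := this
  have hx : ((HomotopyCategory.quotient (ModuleCat.{u} R) (.up ℤ)).map (x • 𝟙 J)) = x • 𝟙 _ := by
    rw [Functor.map_smul, CategoryTheory.Functor.map_id]
  have hT : Pretriangulated.Triangle.mk
      ((HomotopyCategory.quotient (ModuleCat.{u} R) (.up ℤ)).map (x • 𝟙 J)) _ _ ∈
        Pretriangulated.distinguishedTriangles :=
    HomotopyCategory.mappingCone_triangleh_distinguished (x • 𝟙 J)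
  rw [hx] at hT
  exact exists_exact_conj x (cohomologyOfEquiv F J i) (cohomologyOfEquiv F (smulCone x J) i)
    (cohomologyOfEquiv F J j)
    (exists_exact_of_distinguished_map (F.mapHomotopyCategory (.up ℤ)) H x _ _ hT i j h)

section
variable {R : Type u} [CommRing R]

theorem finite_of_function_exact [IsNoetherianRing R] {A B D : Type*}
    [AddCommGroup A] [Module R A] [AddCommGroup B]
    [Module R B] [AddCommGroup D] [Module R D] (f : A →ₗ[R] B) (g : B →ₗ[R] D)
    (h : Function.Exact f g) [Module.Finite R A] [Module.Finite R D] : Module.Finite R B := by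
  have : IsNoetherian R A := isNoetherian_of_isNoetherianRing_of_finite R A
  have : IsNoetherian R D := isNoetherian_of_isNoetherianRing_of_finite R D
  have : IsNoetherian R B := isNoetherian_of_range_eq_ker f g (LinearMap.exact_iff.mp h).symm
  infer_instance

theorem exact_finite [IsNoetherianRing R] {S : ShortComplex (ModuleCat.{v} R)} (h : S.Exact)
    (h₁ : Module.Finite R S.X₁) (h₃ : Module.Finite R S.X₃) : Module.Finite R S.X₂ :=
  finite_of_function_exact S.f.hom S.g.hom ((ShortComplex.ShortExact.moduleCat_exact_iff_function_exact _).1 h)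

/-- The functor sending `N` to the complex obtained by applying `B.obj N` to `J`. -/
noncomputable def evalComplex {D : Type*} [Category* D]
    (B : D ⥤ ModuleCat.{u} R ⥤ ModuleCat.{u} R) [∀ N, (B.obj N).Additive]
    (J : CochainComplex (ModuleCat.{u} R) ℤ) : D ⥤ CochainComplex (ModuleCat.{u} R) ℤ where
  obj N := ((B.obj N).mapHomologicalComplex _).obj J
  map f := (NatTrans.mapHomologicalComplex (B.map f) _).app J

instance {D : Type*} [Category* D] [Limits.HasZeroMorphisms D]
    (B : D ⥤ ModuleCat.{u} R ⥤ ModuleCat.{u} R) [∀ N, (B.obj N).Additive] [B.PreservesZeroMorphisms]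
    (J : CochainComplex (ModuleCat.{u} R) ℤ) : (evalComplex B J).PreservesZeroMorphisms where
  map_zero N L := by
    ext i : 1
    simp [evalComplex]
    rfl

instance linearCoyoneda_obj_linear (N : (ModuleCat.{u} R)ᵒᵖ) :
    ((linearCoyoneda R (ModuleCat.{u} R)).obj N).Linear R where
  map_smul f r := by
    ext g
    exact Linear.comp_smul _ _ _ _ r f

section LongExact

variable {D : Type*} [Category* D] [Limits.HasZeroMorphisms D]
    (B : D ⥤ ModuleCat.{u} R ⥤ ModuleCat.{u} R) [∀ N, (B.obj N).Additive] [B.PreservesZeroMorphisms]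
    (J : CochainComplex (ModuleCat.{u} R) ℤ)

theorem evalComplex_shortExact (S : ShortComplex D)
    (h : ∀ i, (S.map (B.flip.obj (J.X i))).ShortExact) : (S.map (evalComplex B J)).ShortExact :=
  HomologicalComplex.shortExact_of_degreewise_shortExact _ h

variable [IsNoetherianRing R]

theorem finite_cohomologyOf₁ (S : ShortComplex D)
    (h : ∀ i, (S.map (B.flip.obj (J.X i))).ShortExact) (i j : ℤ) (hij : i + 1 = j)
    (h₃ : Module.Finite R (cohomologyOf (B.obj S.X₃) J i))
    (h₂ : Module.Finite R (cohomologyOf (B.obj S.X₂) J j)) :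
    Module.Finite R (cohomologyOf (B.obj S.X₁) J j) :=
  exact_finite ((evalComplex_shortExact B J S h).homology_exact₁ i j hij) (h₁ := h₃) (h₃ := h₂)

theorem finite_cohomologyOf₂ (S : ShortComplex D)
    (h : ∀ i, (S.map (B.flip.obj (J.X i))).ShortExact) (i : ℤ)
    (h₁ : Module.Finite R (cohomologyOf (B.obj S.X₁) J i))
    (h₃ : Module.Finite R (cohomologyOf (B.obj S.X₃) J i)) :
    Module.Finite R (cohomologyOf (B.obj S.X₂) J i) :=
  exact_finite ((evalComplex_shortExact B J S h).homology_exact₂ i) (h₁ := h₁) (h₃ := h₃)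

theorem finite_cohomologyOf₃ (S : ShortComplex D)
    (h : ∀ i, (S.map (B.flip.obj (J.X i))).ShortExact) (i j : ℤ) (hij : i + 1 = j)
    (h₂ : Module.Finite R (cohomologyOf (B.obj S.X₂) J i))
    (h₁ : Module.Finite R (cohomologyOf (B.obj S.X₁) J j)) :
    Module.Finite R (cohomologyOf (B.obj S.X₃) J i) :=
  exact_finite ((evalComplex_shortExact B J S h).homology_exact₃ i j hij) (h₁ := h₂) (h₃ := h₁)

end LongExact
end

section
variable {R : Type u} [CommRing R]

/-- A family of properties of modules, indexed by a degree, which satisfies the formal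
properties of the finiteness of the values of a cohomological functor that is killed by the
ideal `Z`. -/
structure IsDevissage (A : ℤ → ModuleCat.{u} R → Prop) (Z : Ideal R) : Prop where
  quotient : ∀ S : ShortComplex (ModuleCat.{u} R), S.ShortExact →
    ∀ i, A i S.X₁ → A (i + 1) S.X₂ → A (i + 1) S.X₃
  extension : ∀ S : ShortComplex (ModuleCat.{u} R), S.ShortExact →
    ∀ i, A i S.X₁ → A i S.X₃ → A i S.X₂
  smul : ∀ x ∈ Z, ∀ i, (∀ N : ModuleCat.{u} R, Module.Finite R N → A i N) →
    ∀ N : ModuleCat.{u} R, Module.Finite R N →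
      A (i + 1) (ModuleCat.of R (N ⧸ LinearMap.range (LinearMap.lsmul R N x))) → A (i + 1) N
  bounded : ∃ i₀, ∀ i ≤ i₀, ∀ N : ModuleCat.{u} R, Module.Finite R N → A i N

namespace IsDevissage

variable [IsNoetherianRing R] {A : ℤ → ModuleCat.{u} R → Prop} {Z : Ideal R}

theorem of_le_annihilator (hA : IsDevissage A Z) (b : Ideal R)
    (M : ModuleCat.{u} R) (e : M ≃ₗ[R] R ⧸ b) (hb : ∀ i, A i M) (i : ℤ) :
    ∀ N : ModuleCat.{u} R, Module.Finite R N → b ≤ Module.annihilator R N → A i N := by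
  obtain ⟨i₀, h₀⟩ := hA.bounded
  obtain hi | hi := le_total i i₀
  · exact fun N hN _ => h₀ i hi N hN
  induction i, hi using Int.leInduction with
  | base => exact fun N hN _ => h₀ i₀ le_rfl N hN
  | succ i _ ih =>
    have := Module.Finite.equiv e.symm
    have cyclic (N : Type u) [AddCommGroup N] [Module R N] (f : M →ₗ[R] N)
        (hf : Function.Surjective f) : A (i + 1) (ModuleCat.of R N) := by
      refine hA.quotient _ (LinearMap.shortExact_shortComplexKer hf) i
        (ih _ (inferInstanceAs (Module.Finite R (LinearMap.ker f))) ?_) (hb _)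
      refine le_trans ?_ (f.ker.subtype.annihilator_le_of_injective f.ker.subtype_injective)
      rw [e.annihilator_eq, Ideal.annihilator_quotient]
    intro N hN
    refine IsNoetherianRing.induction_on_isQuotientEquivQuotientPrime R hN
      (motive := fun N _ _ _ => b ≤ Module.annihilator R N → A (i + 1) (ModuleCat.of R N)) ?_ ?_ ?_
    · intro N _ _ _ _ _
      exact cyclic N 0 fun y => ⟨0, Subsingleton.elim _ _⟩
    · intro N _ _ _ p e' hN
      rw [e'.annihilator_eq, Ideal.annihilator_quotient] at hN
      exact cyclic N (e'.symm.toLinearMap ∘ₗ Submodule.factor hN ∘ₗ e.toLinearMap)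
        (e'.symm.surjective.comp ((Submodule.factor_surjective hN).comp e.surjective))
    · intro N₁ _ _ _ N₂ _ _ _ N₃ _ _ _ f g hf hg hfg h₁ h₃ hN
      exact hA.extension (ModuleCat.shortComplexOfCompEqZero f g hfg.linearMap_comp_eq_zero)
        (ModuleCat.shortComplex_shortExact _ hfg hf hg) _
        (h₁ (hN.trans (f.annihilator_le_of_injective hf)))
        (h₃ (hN.trans (g.annihilator_le_of_surjective hg)))

theorem of_pow_le_annihilator (hA : IsDevissage A Z) (b : Ideal R)
    (hb : ∀ i, A i (ModuleCat.of R (R ⧸ b))) (i : ℤ) (k : ℕ) :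
    ∀ N : ModuleCat.{u} R, Module.Finite R N → b ^ k ≤ Module.annihilator R N → A i N := by
  induction k with
  | zero =>
    intro N hN h
    refine hA.of_le_annihilator b (ModuleCat.of R (R ⧸ b)) (LinearEquiv.refl R _) hb i N hN (le_trans ?_ h)
    simp
  | succ k ih =>
    intro N hN h
    refine hA.extension _ (LinearMap.shortExact_shortComplexKer
      (b • (⊤ : Submodule R N)).mkQ_surjective) i
      (ih _ (inferInstanceAs (Module.Finite R (LinearMap.ker _))) ?_)
      (hA.of_le_annihilator b (ModuleCat.of R (R ⧸ b)) (LinearEquiv.refl R _) hb i _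
        (inferInstanceAs (Module.Finite R (N ⧸ _))) ?_)
    · intro r hr
      rw [Module.mem_annihilator]
      rintro ⟨n, hn⟩
      rw [Submodule.ker_mkQ] at hn
      ext
      change r • n = 0
      induction hn using Submodule.smul_induction_on' with
      | smul s hs n _ =>
        rw [smul_smul]
        exact Module.mem_annihilator.1 (h (pow_succ b k ▸ Ideal.mul_mem_mul hr hs)) n
      | add x hx y hy h₁ h₂ =>
        rw [Submodule.ker_mkQ] at h₁ h₂
        rw [smul_add, h₁ hx, h₂ hy, add_zero]
    · intro r hr
      rw [Module.mem_annihilator]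
      intro n
      obtain ⟨n, rfl⟩ := Submodule.mkQ_surjective _ n
      rw [← map_smul]
      exact (Submodule.Quotient.mk_eq_zero _).2 (Submodule.smul_mem_smul hr trivial)

theorem of_quotient (hA : IsDevissage A Z) (a : Ideal R) (haZ : a ≤ Z.radical)
    (ha : ∀ i, A i (ModuleCat.of R (R ⧸ a))) (i : ℤ) :
    ∀ N : ModuleCat.{u} R, Module.Finite R N → A i N := by
  obtain ⟨k, hk⟩ := Ideal.exists_pow_le_of_le_radical_of_fg haZ (IsNoetherian.noetherian a)
  obtain ⟨s, hs⟩ := IsNoetherian.noetherian Z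
  obtain ⟨i₀, h₀⟩ := hA.bounded
  obtain hi | hi := le_total i i₀
  · exact h₀ i hi
  induction i, hi using Int.leInduction with
  | base => exact h₀ i₀ le_rfl
  | succ i _ ih =>
    suffices h : ∀ t ⊆ s, ∀ N : ModuleCat.{u} R, Module.Finite R N →
        (∀ y ∈ s, y ∉ t → y ∈ Module.annihilator R N) → A (i + 1) N from
      fun N hN => h s (Finset.Subset.refl s) N hN fun y h h' => absurd h h'
    intro t
    induction t using Finset.cons_induction with
    | empty =>
      intro _ N hN h
      refine hA.of_pow_le_annihilator a ha _ k N hN (hk.trans ?_)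
      rw [← hs, Submodule.span_le]
      exact fun y hy => h y hy (by simp)
    | cons x t hx iht =>
      intro hts N hN h
      rw [Finset.cons_subset] at hts
      refine hA.smul x (hs ▸ Submodule.subset_span hts.1) i ih N hN
        (iht hts.2 _ (inferInstanceAs (Module.Finite R (N ⧸ _))) fun y hy hyt => ?_)
      rw [Module.mem_annihilator]
      intro n
      obtain ⟨n, rfl⟩ := Submodule.mkQ_surjective _ n
      rw [← map_smul]
      by_cases hyx : y = x
      · exact (Submodule.Quotient.mk_eq_zero _).2 ⟨n, by simp [hyx]⟩
      · rw [Module.mem_annihilator.1 (h y hy (by simp [hyx, hyt])), map_zero]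

theorem iff_ring (hA : IsDevissage A Z) (a : Ideal R) (haZ : a ≤ Z.radical) :
    (∀ i, A i (ModuleCat.of R (R ⧸ a))) ↔ ∀ i, A i (ModuleCat.of R R) := by
  refine ⟨fun h i => hA.of_quotient a haZ h i _ inferInstance, fun h i => ?_⟩
  exact hA.of_le_annihilator ⊥ (ModuleCat.of R R) (Submodule.quotEquivOfEqBot ⊥ rfl).symm h i _
    inferInstance bot_le

end IsDevissage
end

section
variable {R : Type u} [CommRing R]

theorem finite_of_comp_eq_zero₁ [IsNoetherianRing R] {T U T' P Q : Type*} [AddCommGroup T]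
    [AddCommGroup U] [AddCommGroup T'] [AddCommGroup P] [AddCommGroup Q] [Module R T] [Module R U]
    [Module R T'] [Module R P] [Module R Q] (_ : Module.Finite R P)
    (_ : Module.Finite R Q)
    {g : T →ₗ[R] U} {f : U →ₗ[R] T'} (h : f ∘ₗ g = 0) {p : P →ₗ[R] T} {q : Q →ₗ[R] U}
    (hp : Function.Exact p g) (hq : Function.Exact q f) : Module.Finite R T := by
  have : IsNoetherian R (LinearMap.range q) := isNoetherian_of_isNoetherianRing_of_finite R _
  have hle : LinearMap.range g ≤ LinearMap.range q := by
    rw [← LinearMap.exact_iff.1 hq]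
    exact LinearMap.range_le_ker_iff.2 h
  have : IsNoetherian R (LinearMap.range g) := isNoetherian_of_le hle
  refine finite_of_function_exact p g.rangeRestrict fun y => ?_
  rw [← hp y, Subtype.ext_iff]
  rfl

theorem finite_of_comp_eq_zero₂ [IsNoetherianRing R] {T U T' P Q : Type*} [AddCommGroup T]
    [AddCommGroup U] [AddCommGroup T'] [AddCommGroup P] [AddCommGroup Q] [Module R T] [Module R U]
    [Module R T'] [Module R P] [Module R Q] (_ : Module.Finite R P)
    (_ : Module.Finite R Q)
    {g : T →ₗ[R] U} {f : U →ₗ[R] T'} (h : f ∘ₗ g = 0) {p : T' →ₗ[R] P} {q : U →ₗ[R] Q}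
    (hp : Function.Exact f p) (hq : Function.Exact g q) : Module.Finite R T' := by
  have : IsNoetherian R Q := isNoetherian_of_isNoetherianRing_of_finite R _
  have hle : LinearMap.ker q ≤ LinearMap.ker f := by
    rw [LinearMap.exact_iff.1 hq]
    exact LinearMap.range_le_ker_iff.2 h
  have : Module.Finite R (U ⧸ LinearMap.ker q) := Module.Finite.equiv q.quotKerEquivRange.symm
  refine finite_of_function_exact ((LinearMap.ker q).liftQ f hle) p ?_
  rw [LinearMap.exact_iff] at hp ⊢
  rw [hp, Submodule.range_liftQ]

theorem homologyMap_evalComplex_comp {D : Type*} [Category* D]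
    (B : D ⥤ ModuleCat.{u} R ⥤ ModuleCat.{u} R) [∀ N, (B.obj N).Additive]
    (J : CochainComplex (ModuleCat.{u} R) ℤ) {N L : D} (f : N ⟶ L) (g : L ⟶ N) (x : R)
    (hfg : ∀ Y, (B.map (f ≫ g)).app Y = x • 𝟙 _) (i : ℤ)
    (hx : ∀ y : cohomologyOf (B.obj N) J i, x • y = 0) :
    (HomologicalComplex.homologyMap ((evalComplex B J).map g) i).hom ∘ₗ
      (HomologicalComplex.homologyMap ((evalComplex B J).map f) i).hom = 0 := by
  have h : (evalComplex B J).map (f ≫ g) = x • 𝟙 ((evalComplex B J).obj N) := by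
    ext i : 1
    exact hfg (J.X i)
  rw [← ModuleCat.hom_comp, ← HomologicalComplex.homologyMap_comp, ← Functor.map_comp, h]
  have := (HomologicalComplex.homologyFunctor (ModuleCat.{u} R) (.up ℤ) i).map_smul x
    (𝟙 ((evalComplex B J).obj N))
  rw [HomologicalComplex.homologyFunctor_map, HomologicalComplex.homologyFunctor_map,
    HomologicalComplex.homologyMap_id] at this
  rw [this]
  ext y
  exact hx y

theorem shortExact_linearCoyoneda (S : ShortComplex (ModuleCat.{u} R)) (hS : S.ShortExact)
    (Y : ModuleCat.{u} R) [Injective Y] :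
    (S.op.map ((linearCoyoneda R (ModuleCat.{u} R)).flip.obj Y)).ShortExact := by
  have := hS.mono_f
  have := hS.epi_g
  refine ModuleCat.shortComplex_shortExact _ (fun (y : S.X₂ ⟶ Y) => ?_) ?_ fun (y : S.X₁ ⟶ Y) => ?_
  · change S.f ≫ y = 0 ↔ ∃ z : S.X₃ ⟶ Y, S.g ≫ z = y
    refine ⟨fun h => ⟨hS.exact.desc y h, hS.exact.g_desc y h⟩, ?_⟩
    rintro ⟨z, rfl⟩
    rw [S.zero_assoc, Limits.zero_comp]
  · intro (y : S.X₃ ⟶ Y) (z : S.X₃ ⟶ Y) (h : S.g ≫ y = S.g ≫ z)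
    exact (cancel_epi S.g).1 h
  · exact ⟨(Injective.factorThru y S.f : S.X₂ ⟶ Y), Injective.comp_factorThru y S.f⟩

theorem shortExact_tensoringLeft (S : ShortComplex (ModuleCat.{u} R)) (hS : S.ShortExact)
    (Y : ModuleCat.{u} R) [Projective Y] :
    (S.map ((MonoidalCategory.tensoringLeft (ModuleCat.{u} R)).flip.obj Y)).ShortExact := by
  have : Module.Projective R Y := (IsProjective.iff_projective (R := R) Y).2 inferInstance
  exact ModuleCat.shortComplex_shortExact _
    (rTensor_exact Y ((ShortComplex.ShortExact.moduleCat_exact_iff_function_exact _).1 hS.exact)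
      hS.moduleCat_surjective_g)
    (Module.Flat.rTensor_preserves_injective_linearMap S.f.hom hS.moduleCat_injective_f)
    (LinearMap.rTensor_surjective Y hS.moduleCat_surjective_g)

end

section
variable {R : Type u} [CommRing R]

/-- The functor `Hom(N, -)`. -/
noncomputable abbrev homFunctor (N : ModuleCat.{u} R) : ModuleCat.{u} R ⥤ ModuleCat.{u} R :=
  (linearCoyoneda R (ModuleCat.{u} R)).obj (Opposite.op N)

/-- The functor `N ⊗ -`. -/
noncomputable abbrev tensorFunctor (N : ModuleCat.{u} R) : ModuleCat.{u} R ⥤ ModuleCat.{u} R :=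
  (MonoidalCategory.tensoringLeft (ModuleCat.{u} R)).obj N

/-- The element `x` kills the cohomology of the complexes obtained by applying the functors
of the family `F` to `J`. -/
def KillsCohomology (F : ModuleCat.{u} R → ModuleCat.{u} R ⥤ ModuleCat.{u} R)
    [∀ N, (F N).Additive] (J : CochainComplex (ModuleCat.{u} R) ℤ) (x : R) : Prop :=
  ∀ N i, ∀ y : cohomologyOf (F N) J i, x • y = 0

variable (x : R) (N : ModuleCat.{u} R)

/-- The inclusion of the kernel of multiplication by `x`, followed by the projection to the image. -/
noncomputable abbrev smulKerShortComplex : ShortComplex (ModuleCat.{u} R) :=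
  (LinearMap.lsmul R N x).rangeRestrict.shortComplexKer

/-- The inclusion of the image of multiplication by `x`, followed by the projection to the
cokernel. -/
noncomputable abbrev smulCokerShortComplex : ShortComplex (ModuleCat.{u} R) :=
  ModuleCat.shortComplexOfCompEqZero (LinearMap.range (LinearMap.lsmul R N x)).subtype
    (LinearMap.range (LinearMap.lsmul R N x)).mkQ (by ext y; simp)

theorem smulKerShortComplex_shortExact : (smulKerShortComplex x N).ShortExact :=
  LinearMap.shortExact_shortComplexKer (LinearMap.surjective_rangeRestrict _)

theorem smulCokerShortComplex_shortExact : (smulCokerShortComplex x N).ShortExact :=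
  ModuleCat.shortComplex_shortExact _ (LinearMap.exact_subtype_mkQ _) (Submodule.subtype_injective _)
    (Submodule.mkQ_surjective _)

theorem smulKer_g_comp_smulCoker_f :
    (smulKerShortComplex x N).g ≫ (smulCokerShortComplex x N).f = x • 𝟙 N := by
  ext y
  rfl

theorem linearCoyoneda_map_smul_id (Y : ModuleCat.{u} R) :
    ((linearCoyoneda R (ModuleCat.{u} R)).map (x • 𝟙 N).op).app Y =
      x • 𝟙 ((homFunctor N).obj Y) := by
  ext (f : N ⟶ Y)
  exact (Linear.smul_comp _ _ _ x (𝟙 N) f).trans (congrArg (fun g => x • g) (Category.id_comp f))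

theorem tensoringLeft_map_smul_id (Y : ModuleCat.{u} R) :
    ((MonoidalCategory.tensoringLeft (ModuleCat.{u} R)).map (x • 𝟙 N)).app Y =
      x • 𝟙 ((tensorFunctor N).obj Y) :=
  (MonoidalLinear.smul_whiskerRight x (𝟙 N) Y).trans
    (by rw [MonoidalCategory.id_whiskerRight]; rfl)

variable [IsNoetherianRing R]

theorem isDevissage_hom (J : CochainComplex (ModuleCat.{u} R) ℤ) [∀ i, Injective (J.X i)]
    (Z : Ideal R) (hZ : ∀ x ∈ Z, KillsCohomology homFunctor J x)
    (hJ : ∃ i₀, ∀ i ≤ i₀, ∀ N : ModuleCat.{u} R, Module.Finite R N →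
      Module.Finite R (cohomologyOf (homFunctor N) J i)) :
    IsDevissage (fun i N => Module.Finite R (cohomologyOf (homFunctor N) J i)) Z where
  quotient S hS i h₁ h₂ := finite_cohomologyOf₁ (linearCoyoneda R (ModuleCat.{u} R)) J S.op
    (fun k => shortExact_linearCoyoneda S hS (J.X k)) i (i + 1) rfl h₁ h₂
  extension S hS i h₁ h₃ := finite_cohomologyOf₂ (linearCoyoneda R (ModuleCat.{u} R)) J S.op
    (fun k => shortExact_linearCoyoneda S hS (J.X k)) i h₃ h₁
  smul x hx i h N hN h' := by
    have e₁ := (evalComplex_shortExact (linearCoyoneda R (ModuleCat.{u} R)) J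
      (smulKerShortComplex x N).op fun k => shortExact_linearCoyoneda _
        (smulKerShortComplex_shortExact x N) (J.X k)).homology_exact₁ i (i + 1) rfl
    have e₂ := (evalComplex_shortExact (linearCoyoneda R (ModuleCat.{u} R)) J
      (smulCokerShortComplex x N).op fun k => shortExact_linearCoyoneda _
        (smulCokerShortComplex_shortExact x N) (J.X k)).homology_exact₂ (i + 1)
    rw [ShortComplex.ShortExact.moduleCat_exact_iff_function_exact] at e₁ e₂
    have := h (ModuleCat.of R (LinearMap.ker (LinearMap.lsmul R N x).rangeRestrict))
      inferInstance
    refine finite_of_comp_eq_zero₁ h' this ?_ e₂ e₁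
    refine homologyMap_evalComplex_comp (linearCoyoneda R (ModuleCat.{u} R)) J
      (smulCokerShortComplex x N).f.op (smulKerShortComplex x N).g.op x ?_ (i + 1)
      (hZ x hx N (i + 1))
    intro Y
    rw [← op_comp, smulKer_g_comp_smulCoker_f]
    exact linearCoyoneda_map_smul_id x N Y
  bounded := hJ

theorem isDevissage_tensor (J : CochainComplex (ModuleCat.{u} R) ℤ) [∀ i, Projective (J.X i)]
    (Z : Ideal R) (hZ : ∀ x ∈ Z, KillsCohomology tensorFunctor J x)
    (hJ : ∃ i₀, ∀ i ≥ i₀, ∀ N : ModuleCat.{u} R, Module.Finite R N →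
      Module.Finite R (cohomologyOf (tensorFunctor N) J i)) :
    IsDevissage (fun i N => Module.Finite R (cohomologyOf (tensorFunctor N) J (-i))) Z where
  quotient S hS i h₁ h₂ := finite_cohomologyOf₃
    (MonoidalCategory.tensoringLeft (ModuleCat.{u} R)) J S
    (fun k => shortExact_tensoringLeft S hS (J.X k)) (-(i + 1)) (-i) (by simp) h₂ h₁
  extension S hS i h₁ h₃ := finite_cohomologyOf₂
    (MonoidalCategory.tensoringLeft (ModuleCat.{u} R)) J S
    (fun k => shortExact_tensoringLeft S hS (J.X k)) (-i) h₁ h₃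
  smul x hx i h N hN h' := by
    have e₁ := (evalComplex_shortExact (MonoidalCategory.tensoringLeft (ModuleCat.{u} R)) J
      (smulKerShortComplex x N) fun k => shortExact_tensoringLeft _
        (smulKerShortComplex_shortExact x N) (J.X k)).homology_exact₃ (-(i + 1)) (-i) (by simp)
    have e₂ := (evalComplex_shortExact (MonoidalCategory.tensoringLeft (ModuleCat.{u} R)) J
      (smulCokerShortComplex x N) fun k => shortExact_tensoringLeft _
        (smulCokerShortComplex_shortExact x N) (J.X k)).homology_exact₂ (-(i + 1))
    rw [ShortComplex.ShortExact.moduleCat_exact_iff_function_exact] at e₁ e₂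
    have := h (ModuleCat.of R (LinearMap.ker (LinearMap.lsmul R N x).rangeRestrict))
      inferInstance
    refine finite_of_comp_eq_zero₂ h' this ?_ e₂ e₁
    refine homologyMap_evalComplex_comp (MonoidalCategory.tensoringLeft (ModuleCat.{u} R)) J
      (smulKerShortComplex x N).g (smulCokerShortComplex x N).f x ?_ (-(i + 1))
      (hZ x hx N (-(i + 1)))
    intro Y
    rw [smulKer_g_comp_smulCoker_f]
    exact tensoringLeft_map_smul_id x N Y
  bounded := by
    obtain ⟨i₀, h⟩ := hJ
    exact ⟨-i₀, fun i hi => h (-i) (by lia)⟩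

end

section
variable {R : Type u} [CommRing R]

section
variable (F : ModuleCat.{u} R ⥤ ModuleCat.{u} R) [F.Additive] (J : CochainComplex (ModuleCat.{u} R) ℤ)

theorem smul_cohomologyOf_eq_zero (x : R) (h : ∀ Y, x • 𝟙 (F.obj Y) = 0) (i : ℤ)
    (y : cohomologyOf F J i) : x • y = 0 := by
  have h' : x • 𝟙 ((F.mapHomologicalComplex (.up ℤ)).obj J) = 0 := by
    ext i : 1
    exact h (J.X i)
  have := (HomologicalComplex.homologyFunctor (ModuleCat.{u} R) (.up ℤ) i).map_smul x
    (𝟙 ((F.mapHomologicalComplex (.up ℤ)).obj J))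
  rw [h', Functor.map_zero, CategoryTheory.Functor.map_id] at this
  exact (ConcreteCategory.congr_hom this y).symm

variable [F.Linear R]

theorem finite_cohomologyOf_smulCone [IsNoetherianRing R] (x : R) (i : ℤ)
    (h₁ : Module.Finite R (cohomologyOf F J i)) (h₂ : Module.Finite R (cohomologyOf F J (i + 1))) :
    Module.Finite R (cohomologyOf F (smulCone x J) i) := by
  obtain ⟨g, δ, -, h, -⟩ := exists_smulCone_exact F x J i (i + 1) rfl
  exact finite_of_function_exact g δ h

theorem finite_cohomologyOf_smulCone_iff [IsNoetherianRing R] (x : R)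
    (hx : ∀ i, ∀ y : cohomologyOf F J i, x • y = 0) :
    (∀ i, Module.Finite R (cohomologyOf F (smulCone x J) i)) ↔
      ∀ i, Module.Finite R (cohomologyOf F J i) := by
  refine ⟨fun h i => ?_, fun h i => finite_cohomologyOf_smulCone F J x i (h i) (h (i + 1))⟩
  obtain ⟨g, δ, hg, -, -⟩ := exists_smulCone_exact F x J i (i + 1) rfl
  refine Module.Finite.of_injective g ((injective_iff_map_eq_zero g).2 fun y hy => ?_)
  obtain ⟨z, rfl⟩ := (hg y).1 hy
  exact hx i z

theorem mul_self_smul_cohomologyOf_smulCone (x : R) (i : ℤ) (y : cohomologyOf F (smulCone x J) i) :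
    (x * x) • y = 0 := by
  obtain ⟨g, δ, h₁, h₂, h₃⟩ := exists_smulCone_exact F x J i (i + 1) rfl
  obtain ⟨z, hz⟩ := (h₂ (x • y)).1 (by rw [map_smul]; exact (h₃ _).2 ⟨y, rfl⟩)
  rw [mul_smul, ← hz, ← map_smul]
  exact (h₁ _).2 ⟨z, rfl⟩

theorem mul_smul_cohomologyOf_smulCone (x y : R) (hy : ∀ i, ∀ z : cohomologyOf F J i, y • z = 0)
    (i : ℤ) (z : cohomologyOf F (smulCone x J) i) : (y * y) • z = 0 := by
  obtain ⟨g, δ, h₁, h₂, h₃⟩ := exists_smulCone_exact F x J i (i + 1) rfl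
  obtain ⟨w, hw⟩ := (h₂ (y • z)).1 (by rw [map_smul, hy])
  rw [mul_smul, ← hw, ← map_smul, hy, map_zero]

end

theorem smul_id_quotient (a : Ideal R) (x : R) (hx : x ∈ a) :
    x • 𝟙 (ModuleCat.of R (R ⧸ a)) = 0 := by
  ext
  change x • (Submodule.Quotient.mk 1 : R ⧸ a) = 0
  rw [← Submodule.Quotient.mk_smul, Submodule.Quotient.mk_eq_zero]
  exact a.mul_mem_right _ hx

theorem smul_cohomologyOf_homFunctor_quotient (J : CochainComplex (ModuleCat.{u} R) ℤ)
    (a : Ideal R) (x : R) (hx : x ∈ a) (i : ℤ)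
    (y : cohomologyOf (homFunctor (ModuleCat.of R (R ⧸ a))) J i) : x • y = 0 := by
  refine smul_cohomologyOf_eq_zero _ J x (fun Y => ?_) i y
  rw [← linearCoyoneda_map_smul_id, smul_id_quotient a x hx]
  ext (f : ModuleCat.of R (R ⧸ a) ⟶ Y)
  exact (Limits.zero_comp : (0 : ModuleCat.of R (R ⧸ a) ⟶ _) ≫ f = 0)

theorem smul_cohomologyOf_tensorFunctor_quotient (J : CochainComplex (ModuleCat.{u} R) ℤ)
    (a : Ideal R) (x : R) (hx : x ∈ a) (i : ℤ)
    (y : cohomologyOf (tensorFunctor (ModuleCat.of R (R ⧸ a))) J i) : x • y = 0 := by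
  refine smul_cohomologyOf_eq_zero _ J x (fun Y => ?_) i y
  rw [← tensoringLeft_map_smul_id, smul_id_quotient a x hx, Functor.map_zero]
  rfl

instance smulCone_injective (x : R) (J : CochainComplex (ModuleCat.{u} R) ℤ)
    [∀ i, Injective (J.X i)] (i : ℤ) : Injective ((smulCone x J).X i) :=
  Injective.of_iso (HomologicalComplex.homotopyCofiber.XIsoBiprod (x • 𝟙 J) i (i + 1) rfl).symm
    inferInstance

instance smulCone_projective (x : R) (J : CochainComplex (ModuleCat.{u} R) ℤ)
    [∀ i, Projective (J.X i)] (i : ℤ) : Projective ((smulCone x J).X i) :=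
  Projective.of_iso (HomologicalComplex.homotopyCofiber.XIsoBiprod (x • 𝟙 J) i (i + 1) rfl).symm
    inferInstance

/-- Two complexes are isomorphic in the derived category. -/
def IsDerivedIso (J K : CochainComplex (ModuleCat.{u} R) ℤ) : Prop :=
  letI := HasDerivedCategory.standard (ModuleCat.{u} R)
  Nonempty (DerivedCategory.Q.obj J ≅ DerivedCategory.Q.obj K)

theorem IsDerivedIso.smulCone {J K : CochainComplex (ModuleCat.{u} R) ℤ} (h : IsDerivedIso J K)
    (x : R) : IsDerivedIso (smulCone x J) (smulCone x K) := by
  let _ := HasDerivedCategory.standard (ModuleCat.{u} R)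
  obtain ⟨e⟩ := h
  refine ⟨Pretriangulated.Triangle.π₃.mapIso (Pretriangulated.isoTriangleOfIso₁₂ _ _
    (DerivedCategory.mappingCone_triangle_distinguished (x • 𝟙 J))
    (DerivedCategory.mappingCone_triangle_distinguished (x • 𝟙 K)) e e ?_)⟩
  change DerivedCategory.Q.map (x • 𝟙 J) ≫ e.hom = e.hom ≫ DerivedCategory.Q.map (x • 𝟙 K)
  rw [Functor.map_smul, Functor.map_smul, CategoryTheory.Functor.map_id,
    CategoryTheory.Functor.map_id, Linear.smul_comp, Linear.comp_smul, Category.id_comp,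
    Category.comp_id]

theorem IsDerivedIso.nonempty_homology {J K : CochainComplex (ModuleCat.{u} R) ℤ}
    (h : IsDerivedIso J K) (i : ℤ) : Nonempty (J.homology i ≅ K.homology i) := by
  let _ := HasDerivedCategory.standard (ModuleCat.{u} R)
  obtain ⟨e⟩ := h
  exact ⟨(DerivedCategory.homologyFunctorFactors (ModuleCat.{u} R) i).symm.app J ≪≫
    (DerivedCategory.homologyFunctor (ModuleCat.{u} R) i).mapIso e ≪≫
    (DerivedCategory.homologyFunctorFactors (ModuleCat.{u} R) i).app K⟩

end

section
variable {R : Type u} [CommRing R]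

/-- The ideal of the elements which kill the cohomology of `(F N)(J)` for all `N`. -/
def killIdeal (F : ModuleCat.{u} R → ModuleCat.{u} R ⥤ ModuleCat.{u} R) [∀ N, (F N).Additive]
    (J : CochainComplex (ModuleCat.{u} R) ℤ) : Ideal R where
  carrier := {x | KillsCohomology F J x}
  add_mem' {x y} hx hy N i z := by rw [add_smul, hx N i z, hy N i z, add_zero]
  zero_mem' N i z := zero_smul R z
  smul_mem' r x hx N i z := by rw [smul_eq_mul, mul_smul, hx N i z, smul_zero]

section
variable (F : ModuleCat.{u} R → ModuleCat.{u} R ⥤ ModuleCat.{u} R) [∀ N, (F N).Additive]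
    [∀ N, (F N).Linear R] (J : CochainComplex (ModuleCat.{u} R) ℤ)

theorem mem_radical_killIdeal_smulCone_self (x : R) : x ∈ (killIdeal F (smulCone x J)).radical :=
  ⟨2, fun N i y => by
    rw [pow_two]
    exact mul_self_smul_cohomologyOf_smulCone (F N) J x i y⟩

theorem radical_killIdeal_le_smulCone (x : R) :
    (killIdeal F J).radical ≤ (killIdeal F (smulCone x J)).radical := by
  rintro y ⟨m, hm⟩
  refine ⟨m + m, fun N i z => ?_⟩
  rw [pow_add]
  exact mul_smul_cohomologyOf_smulCone (F N) J x (y ^ m) (hm N) i z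

end

/-- If `F` is isomorphic to the identity, the complex `F(J)` has the same cohomology as `J`. -/
noncomputable def cohomologyOfIso (F : ModuleCat.{u} R ⥤ ModuleCat.{u} R) [F.Additive] (e : F ≅ 𝟭 _)
    (J : CochainComplex (ModuleCat.{u} R) ℤ) (i : ℤ) : cohomologyOf F J i ≅ J.homology i :=
  (HomologicalComplex.homologyFunctor (ModuleCat.{u} R) (.up ℤ) i).mapIso
    ((NatIso.mapHomologicalComplex e (.up ℤ)).app J ≪≫
      (Functor.mapHomologicalComplexIdIso (ModuleCat.{u} R) (.up ℤ)).app J)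

/-- `Hom(R, -)` is isomorphic to the identity. -/
noncomputable def homFunctorRingIso : homFunctor (ModuleCat.of R R) ≅ 𝟭 (ModuleCat.{u} R) :=
  NatIso.ofComponents (fun Y => (ModuleCat.homLinearEquiv (S := R) (M := ModuleCat.of R R) (N := Y) ≪≫ₗ
    LinearMap.ringLmapEquivSelf R R Y).toModuleIso) fun f => by
      ext g
      rfl

/-- `R ⊗ -` is isomorphic to the identity. -/
noncomputable def tensorFunctorRingIso : tensorFunctor (ModuleCat.of R R) ≅ 𝟭 (ModuleCat.{u} R) :=
  MonoidalCategory.leftUnitorNatIso (ModuleCat.{u} R)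

theorem finite_iff_of_iso {M N : ModuleCat.{u} R} (e : M ≅ N) :
    Module.Finite R M ↔ Module.Finite R N :=
  Module.Finite.equiv_iff e.toLinearEquiv

variable [IsNoetherianRing R]

theorem finite_hom_iff_finite_tensor (a : Ideal R) (s : Set R) (hs : Ideal.span s = a)
    (t : List R) (ht : ∀ x ∈ t, x ∈ a) :
    ∀ (J Q : CochainComplex (ModuleCat.{u} R) ℤ) (_ : ∀ i, Injective (J.X i))
      (_ : ∀ i, Projective (Q.X i)) (_ : IsDerivedIso J Q)
      (_ : ∃ i₀, ∀ i ≤ i₀, ∀ N : ModuleCat.{u} R, Module.Finite R N →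
        Module.Finite R (cohomologyOf (homFunctor N) J i))
      (_ : ∃ i₀, ∀ i ≥ i₀, ∀ N : ModuleCat.{u} R, Module.Finite R N →
        Module.Finite R (cohomologyOf (tensorFunctor N) Q i))
      (_ : ∀ x ∈ s, x ∈ t ∨
        x ∈ (killIdeal homFunctor J).radical ∧ x ∈ (killIdeal tensorFunctor Q).radical),
      (∀ i, Module.Finite R (cohomologyOf (homFunctor (ModuleCat.of R (R ⧸ a))) J i)) ↔
        ∀ i, Module.Finite R (cohomologyOf (tensorFunctor (ModuleCat.of R (R ⧸ a))) Q i) := by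
  induction t with
  | nil =>
    intro J Q _ _ hJQ hJ hQ h
    have h₁ := (isDevissage_hom J (killIdeal homFunctor J) (fun _ hx => hx) hJ).iff_ring a (by
      rw [← hs, Ideal.span_le]
      exact fun x hx => ((h x hx).resolve_left (by simp)).1)
    have h₂ := (isDevissage_tensor Q (killIdeal tensorFunctor Q) (fun _ hx => hx) hQ).iff_ring a (by
      rw [← hs, Ideal.span_le]
      exact fun x hx => ((h x hx).resolve_left (by simp)).2)
    rw [h₁, ← (Equiv.neg ℤ).forall_congr_right, ← (Equiv.neg ℤ).forall_congr_right (q := fun i =>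
      Module.Finite R (cohomologyOf (tensorFunctor (ModuleCat.of R (R ⧸ a))) Q i))]
    refine Iff.trans (forall_congr' fun i => ?_) h₂.symm
    obtain ⟨e⟩ := hJQ.nonempty_homology (-i)
    exact finite_iff_of_iso (cohomologyOfIso _ homFunctorRingIso J (-i) ≪≫ e ≪≫
      (cohomologyOfIso _ tensorFunctorRingIso Q (-i)).symm)
  | cons x t ih =>
    rintro J Q _ _ hJQ ⟨m, hJ⟩ ⟨n, hQ⟩ h
    rw [← finite_cohomologyOf_smulCone_iff _ J x
        (smul_cohomologyOf_homFunctor_quotient J a x (ht x (by simp))),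
      ← finite_cohomologyOf_smulCone_iff _ Q x
        (smul_cohomologyOf_tensorFunctor_quotient Q a x (ht x (by simp)))]
    refine ih (fun y hy => ht y (by simp [hy])) _ _ inferInstance inferInstance (hJQ.smulCone x)
      ⟨m - 1, fun i hi N hN => finite_cohomologyOf_smulCone _ J x i (hJ _ (by lia) N hN)
        (hJ _ (by lia) N hN)⟩
      ⟨n, fun i hi N hN => finite_cohomologyOf_smulCone _ Q x i (hQ _ (by lia) N hN)
        (hQ _ (by lia) N hN)⟩ fun y hy => ?_
    obtain hyt | ⟨h₁, h₂⟩ := h y hy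
    · obtain rfl | hyt := List.mem_cons.1 hyt
      · exact Or.inr ⟨mem_radical_killIdeal_smulCone_self _ J y,
          mem_radical_killIdeal_smulCone_self _ Q y⟩
      · exact Or.inl hyt
    · exact Or.inr ⟨radical_killIdeal_le_smulCone _ J x h₁, radical_killIdeal_le_smulCone _ Q x h₂⟩

end

section
variable {R : Type u} [CommRing R]

theorem finite_homology_iff_of_surjective (S : ShortComplex (ModuleCat.{u} R)) {E : Type*}
    [AddCommGroup E] [Module R E] (φ : LinearMap.ker S.g.hom →ₗ[R] E)
    (hφ : Function.Surjective φ) (h : ∀ z, φ z = 0 ↔ ∃ y, S.f.hom y = z) :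
    Module.Finite R S.homology ↔ Module.Finite R E := by
  have hker : LinearMap.range S.moduleCatToCycles = LinearMap.ker φ := by
    ext z
    rw [LinearMap.mem_ker, h]
    exact ⟨fun ⟨y, hy⟩ => ⟨y, congrArg Subtype.val hy⟩, fun ⟨y, hy⟩ => ⟨y, Subtype.ext hy⟩⟩
  exact (finite_iff_of_iso S.moduleCatHomologyIso).trans (Module.Finite.equiv_iff
    ((Submodule.quotEquivOfEq _ _ hker).trans (φ.quotKerEquivOfSurjective hφ)))

section Ext
variable {X Y : ModuleCat.{u} R}

theorem extMk_zero_eq_zero_iff (P : ProjectiveResolution X) (f : P.complex.X 0 ⟶ Y)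
    (hf : P.complex.d 1 0 ≫ f = 0) : P.extMk f 1 rfl hf = 0 ↔ f = 0 := by
  simp only [← P.extEquivCohomologyClass.apply_eq_iff_eq,
    ProjectiveResolution.extEquivCohomologyClass_extMk,
    ProjectiveResolution.extEquivCohomologyClass_zero,
    CochainComplex.HomComplex.CohomologyClass.mk_eq_zero_iff]
  rw [CochainComplex.HomComplex.Cocycle.toSingleMk_mem_coboundaries_iff _ _ _ _ _ 1 (by simp)]
  have h1 : Limits.IsZero (P.cochainComplex.X 1) :=
    CochainComplex.isZero_of_isStrictlyLE _ 0 _ (by simp)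
  constructor
  · rintro ⟨g, hg⟩
    rw [h1.eq_of_src g 0, Limits.comp_zero] at hg
    rw [← cancel_epi (P.cochainComplexXIso (-(0 : ℕ)) 0 rfl).hom, ← hg, Limits.comp_zero]
  · rintro rfl
    exact ⟨0, by simp⟩

noncomputable def projExtMk (P : ProjectiveResolution X) (n : ℕ) :
    LinearMap.ker ((P.complex.linearYonedaObj R Y).sc' ((ComplexShape.up ℕ).prev n) n (n + 1)).g.hom
      →ₗ[R] CategoryTheory.Abelian.Ext.{u} X Y n where
  toFun z := P.extMk z.1 (n + 1) rfl z.2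
  map_add' z w := (P.add_extMk _ _ _ _ _ _).symm
  map_smul' r z := by
    have := P.extMk_comp_mk₀ z.1 (n + 1) rfl z.2 (r • 𝟙 Y)
    rw [RingHom.id_apply, Abelian.Ext.smul_eq_comp_mk₀, this]
    congr 1

theorem projExtMk_eq_zero_iff (P : ProjectiveResolution X) (n : ℕ)
    (z : LinearMap.ker ((P.complex.linearYonedaObj R Y).sc'
      ((ComplexShape.up ℕ).prev n) n (n + 1)).g.hom) :
    projExtMk P n z = 0 ↔ ∃ y, ((P.complex.linearYonedaObj R Y).sc'
      ((ComplexShape.up ℕ).prev n) n (n + 1)).f.hom y = z.1 := by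
  obtain _ | n := n
  · refine (extMk_zero_eq_zero_iff P z.1 z.2).trans ?_
    have : (P.complex.linearYonedaObj R Y).d ((ComplexShape.up ℕ).prev 0) 0 = 0 :=
      (P.complex.linearYonedaObj R Y).shape _ _ (by simp)
    change _ ↔ ∃ y, ((P.complex.linearYonedaObj R Y).d ((ComplexShape.up ℕ).prev 0) 0).hom y = z.1
    rw [this]
    exact ⟨fun h => ⟨0, h.symm⟩, fun ⟨_, h⟩ => h.symm⟩
  · refine P.extMk_eq_zero_iff z.1 _ rfl z.2 ((ComplexShape.up ℕ).prev (n + 1)) (by simp)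

theorem finite_ext_iff_finite_abelianExt (P : ProjectiveResolution X) (n : ℕ) :
    Module.Finite R (((Ext R (ModuleCat.{u} R) n).obj (Opposite.op X)).obj Y) ↔
      Module.Finite R (CategoryTheory.Abelian.Ext.{u} X Y n) := by
  rw [finite_iff_of_iso (P.isoExt n Y), finite_iff_of_iso
    ((P.complex.linearYonedaObj R Y).homologyIsoSc' _ n (n + 1) rfl (by simp))]
  refine finite_homology_iff_of_surjective _ (projExtMk P n) (fun α => ?_)
    (projExtMk_eq_zero_iff P n)
  obtain ⟨f, hf, rfl⟩ := P.extMk_surjective α (n + 1) rfl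
  exact ⟨⟨f, hf⟩, rfl⟩

theorem comp_cochainComplexXIso_comp_d (I : InjectiveResolution Y) (n : ℕ)
    (f : X ⟶ I.cochainComplex.X n) (hf : f ≫ I.cochainComplex.d n (n + 1) = 0) :
    (f ≫ (I.cochainComplexXIso n n rfl).hom) ≫ I.cocomplex.d n (n + 1) = 0 := by
  rw [I.cochainComplex_d n (n + 1) n (n + 1) rfl (by simp)] at hf
  simpa using hf =≫ (I.cochainComplexXIso _ (n + 1) (by simp)).hom

theorem extMk_comp_cochainComplexXIso_eq_zero_iff (I : InjectiveResolution Y) (n : ℕ)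
    (f : X ⟶ I.cochainComplex.X n)
    (hf : (f ≫ (I.cochainComplexXIso n n rfl).hom) ≫ I.cocomplex.d n (n + 1) = 0) :
    I.extMk (f ≫ (I.cochainComplexXIso n n rfl).hom) (n + 1) rfl hf = 0 ↔
      ∃ g : X ⟶ _, g ≫ I.cochainComplex.d ((n : ℤ) - 1) n = f := by
  simp only [← I.extEquivCohomologyClass.apply_eq_iff_eq,
    InjectiveResolution.extEquivCohomologyClass_extMk,
    InjectiveResolution.extEquivCohomologyClass_zero,
    CochainComplex.HomComplex.CohomologyClass.mk_eq_zero_iff]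
  rw [CochainComplex.HomComplex.Cocycle.fromSingleMk_mem_coboundaries_iff _ _ _ _ _
    ((n : ℤ) - 1) (by simp), Category.assoc, Iso.hom_inv_id, Category.comp_id]

noncomputable def injExtMk (I : InjectiveResolution Y) (n : ℕ) :
    LinearMap.ker (((((homFunctor X).mapHomologicalComplex _).obj I.cochainComplex).sc'
      ((n : ℤ) - 1) n (n + 1)).g.hom) →ₗ[R] CategoryTheory.Abelian.Ext.{u} X Y n where
  toFun z := I.extMk ((show X ⟶ _ from z.1) ≫ (I.cochainComplexXIso n n rfl).hom) (n + 1) rfl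
    (comp_cochainComplexXIso_comp_d I n z.1 z.2)
  map_add' z w := by
    rw [I.add_extMk]
    congr 1
    exact Preadditive.add_comp _ _ _ _ _ _
  map_smul' r z := by
    rw [RingHom.id_apply, ← Abelian.Ext.mk₀_id_comp (r • _), Abelian.Ext.comp_smul,
      ← Abelian.Ext.smul_comp, ← Abelian.Ext.mk₀_smul, I.mk₀_comp_extMk]
    congr 1
    rw [Linear.smul_comp, Category.id_comp]
    exact Linear.smul_comp _ _ _ _ _ _

theorem injExtMk_eq_zero_iff (I : InjectiveResolution Y) (n : ℕ) (z) :
    injExtMk (X := X) I n z = 0 ↔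
      ∃ y, ((((homFunctor X).mapHomologicalComplex _).obj I.cochainComplex).sc'
      ((n : ℤ) - 1) n (n + 1)).f.hom y = z.1 :=
  extMk_comp_cochainComplexXIso_eq_zero_iff I n z.1
    (comp_cochainComplexXIso_comp_d I n z.1 z.2)

theorem finite_cohomologyOf_homFunctor_iff (I : InjectiveResolution Y) (n : ℕ) :
    Module.Finite R (cohomologyOf (homFunctor X) I.cochainComplex n) ↔
      Module.Finite R (CategoryTheory.Abelian.Ext.{u} X Y n) := by
  rw [finite_iff_of_iso
    (HomologicalComplex.homologyIsoSc' _ ((n : ℤ) - 1) n (n + 1) (by simp) (by simp))]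
  refine finite_homology_iff_of_surjective _ (injExtMk I n) (fun α => ?_)
    (injExtMk_eq_zero_iff I n)
  obtain ⟨f, hf, rfl⟩ := I.extMk_surjective α (n + 1) rfl
  refine ⟨⟨f ≫ (I.cochainComplexXIso n n rfl).inv, ?_⟩, ?_⟩
  · change (f ≫ (I.cochainComplexXIso n n rfl).inv) ≫ I.cochainComplex.d n (n + 1) = 0
    rw [I.cochainComplex_d n (n + 1) n (n + 1) rfl (by simp)]
    simp [reassoc_of% hf]
  · change I.extMk ((f ≫ (I.cochainComplexXIso n n rfl).inv) ≫
      (I.cochainComplexXIso n n rfl).hom) (n + 1) rfl (by simpa using hf) = _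
    simp

end Ext
end

section
variable {R : Type u} [CommRing R]

theorem nonempty_homology_cochainComplex_iso {Y : ModuleCat.{u} R} (P : ProjectiveResolution Y)
    (F : ModuleCat.{u} R ⥤ ModuleCat.{u} R) [F.Additive] (n : ℕ) :
    Nonempty (cohomologyOf F P.cochainComplex (-n) ≅
      ((F.mapHomologicalComplex _).obj P.complex).homology n) := by
  let S := ((F.mapHomologicalComplex _).obj P.cochainComplex).sc' (-(n + 1 : ℕ)) (-n) (1 - n)
  let S' := ((F.mapHomologicalComplex _).obj P.complex).sc' (n + 1) n
    ((ComplexShape.down ℕ).next n)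
  let e (k : ℕ) := F.mapIso (P.cochainComplexXIso (-k) k rfl)
  have h₁₂ : (e (n + 1)).hom ≫ S'.f = S.f ≫ (e n).hom := by
    change F.map _ ≫ F.map _ = F.map _ ≫ F.map _
    rw [← F.map_comp, ← F.map_comp, P.cochainComplex_d _ _ (n + 1) n rfl rfl]
    simp
  suffices h : ∃ τ₃ : S.X₃ ⟶ S'.X₃, Mono τ₃ ∧ (e n).hom ≫ S'.g = S.g ≫ τ₃ by
    obtain ⟨τ₃, _, h₂₃⟩ := h
    let φ : S ⟶ S' := { τ₁ := (e (n + 1)).hom, τ₂ := (e n).hom, τ₃ := τ₃ }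
    have : Epi φ.τ₁ := inferInstanceAs (Epi (e (n + 1)).hom)
    have : IsIso φ.τ₂ := inferInstanceAs (IsIso (e n).hom)
    have : Mono φ.τ₃ := ‹_›
    exact ⟨HomologicalComplex.homologyIsoSc' _ _ _ _ (by simp; ring) (by simp; ring) ≪≫
      asIso (ShortComplex.homologyMap φ) ≪≫
      (HomologicalComplex.homologyIsoSc' _ _ _ _ (by simp) rfl).symm⟩
  obtain _ | n := n
  · have h₁ : Limits.IsZero (P.cochainComplex.X (1 - (0 : ℕ))) :=
      CochainComplex.isZero_of_isStrictlyLE P.cochainComplex 0 _ (by simp)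
    have hS : Limits.IsZero S.X₃ := F.map_isZero h₁
    refine ⟨0, ⟨fun _ _ _ => hS.eq_of_tgt _ _⟩, ?_⟩
    rw [Limits.comp_zero]
    have : S'.g = 0 :=
      ((F.mapHomologicalComplex _).obj P.complex).shape 0 ((ComplexShape.down ℕ).next 0) (by simp)
    rw [this]
    exact Limits.comp_zero
  · have hn : (ComplexShape.down ℕ).next (n + 1) = n := by simp
    let e' := P.cochainComplexXIso (1 - (n + 1 : ℕ)) ((ComplexShape.down ℕ).next (n + 1))
      (by rw [hn]; push_cast; ring)
    refine ⟨(F.mapIso e').hom, inferInstanceAs (Mono (F.mapIso e').hom), ?_⟩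
    change F.map _ ≫ F.map _ = F.map _ ≫ F.map _
    rw [← F.map_comp, ← F.map_comp, P.cochainComplex_d _ _ (n + 1)
      ((ComplexShape.down ℕ).next (n + 1)) rfl (by rw [hn]; push_cast; ring)]
    simp [e']

theorem finite_cohomologyOf_tensorFunctor_iff {X Y : ModuleCat.{u} R} (P : ProjectiveResolution Y)
    (n : ℕ) : Module.Finite R (cohomologyOf (tensorFunctor X) P.cochainComplex (-n)) ↔
      Module.Finite R (((Tor (ModuleCat.{u} R) n).obj X).obj Y) := by
  obtain ⟨e⟩ := nonempty_homology_cochainComplex_iso P (tensorFunctor X) n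
  exact (finite_iff_of_iso e).trans (finite_iff_of_iso (P.isoLeftDerivedObj _ n)).symm

theorem finite_cohomologyOf_of_isZero (F : ModuleCat.{u} R ⥤ ModuleCat.{u} R) [F.Additive]
    (J : CochainComplex (ModuleCat.{u} R) ℤ) (i : ℤ) (h : Limits.IsZero (J.X i)) :
    Module.Finite R (cohomologyOf F J i) := by
  have : Subsingleton (cohomologyOf F J i) :=
    ModuleCat.subsingleton_of_isZero (ShortComplex.isZero_homology_of_isZero_X₂
    (((F.mapHomologicalComplex _).obj J).sc i) (F.map_isZero h))
  exact inferInstance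

theorem isDerivedIso_resolutions {Y : ModuleCat.{u} R} (I : InjectiveResolution Y)
    (P : ProjectiveResolution Y) : IsDerivedIso I.cochainComplex P.cochainComplex := by
  let _ := HasDerivedCategory.standard (ModuleCat.{u} R)
  exact ⟨(asIso (DerivedCategory.Q.map I.ι')).symm ≪≫ (asIso (DerivedCategory.Q.map P.π')).symm⟩

end

/-- For an ideal `a` of a commutative noetherian ring `R` and an `R`-module `M`,
all the modules `Ext^i(R/a, M)` are finitely generated if and only if
all the modules `Tor_i(R/a, M)` are finitely generated. -/
theorem ext_finite_iff_tor_finite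
    {R : Type u} [CommRing R] [IsNoetherianRing R] (a : Ideal R)
    (M : Type u) [AddCommGroup M] [Module R M] :
    (∀ i : ℕ, Module.Finite R
        (((Ext R (ModuleCat.{u} R) i).obj
          (Opposite.op (ModuleCat.of R (R ⧸ a)))).obj (ModuleCat.of R M))) ↔
      (∀ i : ℕ, Module.Finite R
        (((Tor (ModuleCat.{u} R) i).obj (ModuleCat.of R (R ⧸ a))).obj (ModuleCat.of R M))) := by
  obtain ⟨I⟩ := (HasInjectiveResolutions.out (ModuleCat.of R M)).out
  obtain ⟨P⟩ := (HasProjectiveResolutions.out (ModuleCat.of R M)).out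
  obtain ⟨P'⟩ := (HasProjectiveResolutions.out (ModuleCat.of R (R ⧸ a))).out
  obtain ⟨s, hs⟩ := IsNoetherian.noetherian a
  have hI (F : ModuleCat.{u} R ⥤ ModuleCat.{u} R) [F.Additive] (i : ℤ) (hi : i < 0) :
      Module.Finite R (cohomologyOf F I.cochainComplex i) :=
    finite_cohomologyOf_of_isZero F _ i (CochainComplex.isZero_of_isStrictlyGE _ 0 _ hi)
  have hP (F : ModuleCat.{u} R ⥤ ModuleCat.{u} R) [F.Additive] (i : ℤ) (hi : 0 < i) :
      Module.Finite R (cohomologyOf F P.cochainComplex i) :=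
    finite_cohomologyOf_of_isZero F _ i (CochainComplex.isZero_of_isStrictlyLE _ 0 _ hi)
  have key := finite_hom_iff_finite_tensor a s hs s.toList
    (fun x hx => hs ▸ Ideal.subset_span (Finset.mem_toList.1 hx))
    I.cochainComplex P.cochainComplex inferInstance inferInstance (isDerivedIso_resolutions I P)
    ⟨-1, fun i hi N _ => hI _ i (by omega)⟩ ⟨1, fun i hi N _ => hP _ i (by omega)⟩
    (fun x hx => Or.inl (Finset.mem_toList.2 hx))
  calc
    _ ↔ ∀ i : ℤ, Module.Finite R
        (cohomologyOf (homFunctor (ModuleCat.of R (R ⧸ a))) I.cochainComplex i) := by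
      refine ⟨fun h i => ?_, fun h n => ?_⟩
      · obtain hi | hi := lt_or_ge i 0
        · exact hI _ i hi
        · lift i to ℕ using hi
          rw [finite_cohomologyOf_homFunctor_iff, ← finite_ext_iff_finite_abelianExt P']
          exact h i
      · rw [finite_ext_iff_finite_abelianExt P', ← finite_cohomologyOf_homFunctor_iff I]
        exact h n
    _ ↔ _ := key
    _ ↔ _ := by
      refine ⟨fun h n => (finite_cohomologyOf_tensorFunctor_iff P n).1 (h _), fun h i => ?_⟩
      obtain hi | hi := lt_or_ge 0 i
      · exact hP _ i hi
      · obtain ⟨n, rfl⟩ := Int.exists_eq_neg_ofNat hi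
        exact (finite_cohomologyOf_tensorFunctor_iff P n).2 (h n)
end

section
/- Let R be a commutative noetherian ring with unity, let a be an ideal of R, and let M be an R-module. If Ext^i_R(R/a, M) is a finitely generated R-module for every i ≥ 0, then Ext^i_R(N, M) is a finitely generated R-module for every finitely generated R-module N with Supp_R(N) ⊆ V(a) and every i ≥ 0. -/
open CategoryTheory

noncomputable section

universe w v u t

/-- A surjective linear map from the cycles of a short complex of modules whose kernel consists of
the boundaries identifies its target with the homology. -/
def CategoryTheory.ShortComplex.moduleCatHomologyLinearEquiv
    {R : Type*} [Ring R] (S : ShortComplex (ModuleCat.{v} R))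
    {E : Type*} [AddCommGroup E] [Module R E]
    (φ : LinearMap.ker S.g.hom →ₗ[R] E) (hφ : Function.Surjective φ)
    (hker : LinearMap.range S.moduleCatToCycles = LinearMap.ker φ) : S.homology ≃ₗ[R] E :=
  S.moduleCatHomologyIso.toLinearEquiv ≪≫ₗ
    Submodule.quotEquivOfEq _ _ hker ≪≫ₗ φ.quotKerEquivOfSurjective hφ

namespace CategoryTheory.ProjectiveResolution

variable {R : Type t} [CommRing R] {C : Type u} [Category.{v} C] [Abelian C] [Linear R C]
  [HasExt.{w} C]
variable {X : C} (P : ProjectiveResolution X) (Y : C) (n : ℕ)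

variable {Y} in
lemma extMk_zero_eq_zero_iff (f : P.complex.X 0 ⟶ Y) (hf : P.complex.d 1 0 ≫ f = 0) :
    P.extMk f 1 rfl hf = 0 ↔ f = 0 := by
  refine ⟨fun h ↦ ?_, by rintro rfl; simp⟩
  rw [← P.extEquivCohomologyClass.apply_eq_iff_eq, extEquivCohomologyClass_extMk,
    extEquivCohomologyClass_zero, CochainComplex.HomComplex.CohomologyClass.mk_eq_zero_iff,
    CochainComplex.HomComplex.Cocycle.toSingleMk_mem_coboundaries_iff _ _ _ _ _ 1 (by lia)] at h
  obtain ⟨g, hg⟩ := h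
  have hz : Limits.IsZero (P.cochainComplex.X 1) := by
    apply CochainComplex.isZero_of_isStrictlyLE _ 0 _ (by lia)
  rw [hz.eq_of_src g 0] at hg
  simpa using hg.symm

variable {Y n} in
lemma smul_extMk (r : R) (f : P.complex.X n ⟶ Y) (m : ℕ) (hm : n + 1 = m)
    (hf : P.complex.d m n ≫ f = 0) :
    r • P.extMk f m hm hf = P.extMk (r • f) m hm (by simp [hf]) := by
  rw [Abelian.Ext.smul_eq_comp_mk₀, extMk_comp_mk₀]
  congr 1
  simp

variable (R) in
/-- The short complex of modules of morphisms to `Y` around degree `n` of a projective resolution. -/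
abbrev linearYonedaSc : ShortComplex (ModuleCat.{v} R) :=
  (P.complex.linearYonedaObj R Y).sc' ((ComplexShape.up ℕ).prev n) n (n + 1)

variable (R) in
/-- The linear map sending a cocycle of a projective resolution to its class in `Ext`. -/
def cocyclesToExt : LinearMap.ker (P.linearYonedaSc R Y n).g.hom →ₗ[R] Abelian.Ext X Y n where
  toFun f := P.extMk f.1 (n + 1) rfl f.2
  map_add' _ _ := (P.add_extMk _ _ _ _ _ _).symm
  map_smul' _ _ := (P.smul_extMk _ _ _ _ _).symm

lemma cocyclesToExt_surjective : Function.Surjective (P.cocyclesToExt R Y n) := fun x ↦ by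
  obtain ⟨f, hf, rfl⟩ := P.extMk_surjective x (n + 1) rfl
  exact ⟨⟨f, hf⟩, rfl⟩

lemma range_moduleCatToCycles_linearYonedaSc :
    LinearMap.range (P.linearYonedaSc R Y n).moduleCatToCycles =
      LinearMap.ker (P.cocyclesToExt R Y n) := by
  ext ⟨f, hf⟩
  rw [LinearMap.mem_ker]
  change (∃ g, _) ↔ P.extMk f (n + 1) rfl hf = 0
  have key (g : P.complex.X ((ComplexShape.up ℕ).prev n) ⟶ Y) :
      (P.linearYonedaSc R Y n).moduleCatToCycles g = ⟨f, hf⟩ ↔ P.complex.d n _ ≫ g = f :=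
    Subtype.ext_iff
  refine (exists_congr key).trans ?_
  cases n with
  | zero =>
    refine Iff.trans ?_ (P.extMk_zero_eq_zero_iff f hf).symm
    refine ⟨fun ⟨g, hg⟩ ↦ ?_, fun h ↦ ⟨0, ?_⟩⟩
    · rw [← hg, P.complex.shape _ _ (by simp)]
      exact Limits.zero_comp
    · rw [h]
      exact Limits.comp_zero
  | succ n =>
    refine Iff.trans ?_ (P.extMk_eq_zero_iff f _ rfl hf n rfl).symm
    rw [CochainComplex.prev_nat_succ]

variable [EnoughProjectives C]

variable (R) in
/-- The `Ext` modules defined through projective resolutions agree with those defined through the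
derived category. -/
def extLinearEquiv :
    ((Ext R C n).obj (Opposite.op X)).obj Y ≃ₗ[R] Abelian.Ext X Y n :=
  (P.isoExt n Y ≪≫
      HomologicalComplex.homologyIsoSc' _ _ n (n + 1) rfl (by simp)).toLinearEquiv ≪≫ₗ
    (P.linearYonedaSc R Y n).moduleCatHomologyLinearEquiv (P.cocyclesToExt R Y n)
      (P.cocyclesToExt_surjective Y n) (P.range_moduleCatToCycles_linearYonedaSc Y n)

end CategoryTheory.ProjectiveResolution

namespace CategoryTheory.Abelian.Ext

variable {R : Type t} [CommRing R] {C : Type u} [Category.{v} C] [Abelian C] [Linear R C]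
  [HasExt.{w} C] {S : ShortComplex C}

lemma isNoetherian_X₂_of_shortExact (hS : S.ShortExact) (Y : C) (n : ℕ)
    [IsNoetherian R (Ext S.X₁ Y n)] [IsNoetherian R (Ext S.X₃ Y n)] :
    IsNoetherian R (Ext S.X₂ Y n) := by
  refine isNoetherian_of_range_eq_ker
    ((mk₀ S.g).precompOfLinear R Y (zero_add n)) ((mk₀ S.f).precompOfLinear R Y (zero_add n)) ?_
  ext x
  refine ⟨?_, fun hx ↦ contravariant_sequence_exact₂ hS Y x hx⟩
  rintro ⟨y, rfl⟩
  simp [LinearMap.mem_ker]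

lemma isNoetherian_X₃_zero_of_shortExact (hS : S.ShortExact) (Y : C)
    [IsNoetherian R (Ext S.X₂ Y 0)] : IsNoetherian R (Ext S.X₃ Y 0) :=
  have := hS.epi_g
  isNoetherian_of_injective ((mk₀ S.g).precompOfLinear R Y (zero_add 0))
    (precomp_mk₀_injective_of_epi Y S.g)

lemma isNoetherian_X₃_succ_of_shortExact (hS : S.ShortExact) (Y : C) (n : ℕ)
    [IsNoetherian R (Ext S.X₁ Y n)] [IsNoetherian R (Ext S.X₂ Y (n + 1))] :
    IsNoetherian R (Ext S.X₃ Y (n + 1)) := by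
  refine isNoetherian_of_range_eq_ker
    (hS.extClass.precompOfLinear R Y (add_comm 1 n))
    ((mk₀ S.g).precompOfLinear R Y (zero_add (n + 1))) ?_
  ext x
  refine ⟨?_, fun hx ↦ contravariant_sequence_exact₃ hS Y x hx (add_comm 1 n)⟩
  rintro ⟨y, rfl⟩
  simp [LinearMap.mem_ker]

end CategoryTheory.Abelian.Ext

namespace ModuleCat

variable {R : Type u} [CommRing R] [IsNoetherianRing R]

/-- If `Ext^i(R/a, M)` is noetherian for every `i`, then so is `Ext^i(N, M)` for every finite module
`N` with support in `V(a)`, by dévissage to the modules `R/p` with `p ⊇ a`. -/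
lemma isNoetherian_ext_of_support_subset (a : Ideal R) (M : ModuleCat.{u} R)
    (h : ∀ i, IsNoetherian R (Abelian.Ext (of R (R ⧸ a)) M i)) (i : ℕ)
    (N : Type u) [AddCommGroup N] [Module R N] [hfin : Module.Finite R N]
    (hN : Module.support R N ⊆ PrimeSpectrum.zeroLocus (a : Set R)) :
    IsNoetherian R (Abelian.Ext (of R N) M i) := by
  induction i using Nat.strong_induction_on generalizing N with | _ i ih
  induction hfin using IsNoetherianRing.induction_on_isQuotientEquivQuotientPrime R with
  | subsingleton N =>
    have : Subsingleton (Abelian.Ext (of R N) M i) := by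
      refine ⟨fun x y ↦ ?_⟩
      have key (x : Abelian.Ext (of R N) M i) : x = 0 := by
        rw [← Abelian.Ext.mk₀_id_comp x, (isZero_of_subsingleton (of R N)).eq_of_src (𝟙 _) 0]
        simp
      rw [key x, key y]
    infer_instance
  | quotient N p e =>
    have hap : a ≤ p.1 := by
      have : p ∈ Module.support R N := by
        rw [e.support_eq, Module.support_eq_zeroLocus, Ideal.annihilator_quotient]
        exact le_refl p.1
      exact hN this
    let f : (R ⧸ a) →ₗ[R] N := e.symm.toLinearMap ∘ₗ Submodule.factor hap
    have hf : Function.Surjective f := e.symm.surjective.comp (Submodule.factor_surjective hap)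
    have hS := LinearMap.shortExact_shortComplexKer hf
    have := h i
    cases i with
    | zero => exact Abelian.Ext.isNoetherian_X₃_zero_of_shortExact hS M
    | succ i =>
      have := ih i i.lt_succ_self (LinearMap.ker f) <|
        (Module.support_subset_of_injective _ (LinearMap.ker f).injective_subtype).trans <| by
          rw [Module.support_eq_zeroLocus, Ideal.annihilator_quotient]
      exact Abelian.Ext.isNoetherian_X₃_succ_of_shortExact hS M i
  | exact N₁ N₂ N₃ f g hf hg hfg h₁ h₃ =>
    have := h₁ ((Module.support_subset_of_injective f hf).trans hN)
    have := h₃ ((Module.support_subset_of_surjective g hg).trans hN)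
    have hS := shortComplex_shortExact
      (shortComplexOfCompEqZero f g hfg.linearMap_comp_eq_zero) hfg hf hg
    exact Abelian.Ext.isNoetherian_X₂_of_shortExact hS M i

end ModuleCat

end

/-- If `Ext^i(R/a, M)` is finitely generated for every `i ≥ 0`, then `Ext^i(N, M)` is finitely
generated for every finitely generated module `N` with `Supp N ⊆ V(a)` and every `i ≥ 0`. -/
theorem ext_finite_of_ext_quotient_finite
    {R : Type u} [CommRing R] [IsNoetherianRing R] (a : Ideal R)
    (M : Type u) [AddCommGroup M] [Module R M]
    (h : ∀ i : ℕ, Module.Finite R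
      (((Ext R (ModuleCat.{u} R) i).obj
        (Opposite.op (ModuleCat.of R (R ⧸ a)))).obj (ModuleCat.of R M)))
    (N : Type u) [AddCommGroup N] [Module R N] [Module.Finite R N]
    (hN : Module.support R N ⊆ PrimeSpectrum.zeroLocus (a : Set R)) (i : ℕ) :
    Module.Finite R (((Ext R (ModuleCat.{u} R) i).obj
      (Opposite.op (ModuleCat.of R N))).obj (ModuleCat.of R M)) := by
  have key := ModuleCat.isNoetherian_ext_of_support_subset a (ModuleCat.of R M)
    (fun j ↦ isNoetherian_of_linearEquiv (M := ((Ext R (ModuleCat.{u} R) j).obj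
        (Opposite.op (ModuleCat.of R (R ⧸ a)))).obj (ModuleCat.of R M))
      ((projectiveResolution (ModuleCat.of R (R ⧸ a))).extLinearEquiv R _ j)) i N hN
  exact Module.Finite.equiv
    ((projectiveResolution (ModuleCat.of R N)).extLinearEquiv R (ModuleCat.of R M) i).symm
end

section
/- Let R be a commutative noetherian ring with unity, let a be an ideal of R, let M be an R-module, and let c = cd(a,R) = sup{ i ≥ 0 : H^i_a(R) ≠ 0 } be the cohomological dimension of R with respect to a. If Tor^R_i(R/a, M) is a finitely generated R-module for every 0 ≤ i ≤ c, then Tor^R_i(R/a, M) is a finitely generated R-module for every i ≥ 0. -/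
open CategoryTheory

section TorSequence

universe u

variable {R : Type u} [CommRing R]

/-- The complex `X ⊗ P` computing `Tor (X, M)`, where `P` is a projective resolution of `M`. -/
noncomputable def torComplex (M X : ModuleCat.{u} R) : ChainComplex (ModuleCat.{u} R) ℕ :=
  (((MonoidalCategory.tensoringLeft (ModuleCat.{u} R)).obj X).mapHomologicalComplex _).obj
    (projectiveResolution M).complex

noncomputable def torComplexMap (M : ModuleCat.{u} R) {X Y : ModuleCat.{u} R} (f : X ⟶ Y) :
    torComplex M X ⟶ torComplex M Y :=
  (NatTrans.mapHomologicalComplex ((MonoidalCategory.tensoringLeft (ModuleCat.{u} R)).map f) _).app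
    (projectiveResolution M).complex

lemma torComplexMap_comp (M : ModuleCat.{u} R) {X Y Z : ModuleCat.{u} R} (f : X ⟶ Y) (g : Y ⟶ Z) :
    torComplexMap M (f ≫ g) = torComplexMap M f ≫ torComplexMap M g := by
  simp [torComplexMap]
  rfl

lemma torComplexMap_id (M X : ModuleCat.{u} R) : torComplexMap M (𝟙 X) = 𝟙 _ := by
  simp [torComplexMap]
  rfl

lemma torComplexMap_zero (M : ModuleCat.{u} R) (X Y : ModuleCat.{u} R) :
    torComplexMap M (0 : X ⟶ Y) = 0 := by
  ext i : 1
  simp [torComplexMap]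
  rfl

/-- `torComplex` computes `Tor`. -/
noncomputable def torIso (M X : ModuleCat.{u} R) (i : ℕ) :
    ((Tor (ModuleCat.{u} R) i).obj X).obj M ≅ (torComplex M X).homology i :=
  (projectiveResolution M).isoLeftDerivedObj _ i

/-- The short complex of complexes computing `Tor (-, M)` of a short complex of modules. -/
noncomputable def torShortComplex (M : ModuleCat.{u} R) (S : ShortComplex (ModuleCat.{u} R)) :
    ShortComplex (ChainComplex (ModuleCat.{u} R) ℕ) :=
  ShortComplex.mk (torComplexMap M S.f) (torComplexMap M S.g)
    (by rw [← torComplexMap_comp, S.zero, torComplexMap_zero])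

lemma torShortComplex_shortExact (M : ModuleCat.{u} R) {S : ShortComplex (ModuleCat.{u} R)}
    (hS : S.ShortExact) : (torShortComplex M S).ShortExact := by
  apply HomologicalComplex.shortExact_of_degreewise_shortExact
  intro i
  have : Projective ((projectiveResolution M).complex.X i) := (projectiveResolution M).projective i
  have : Module.Projective R ((projectiveResolution M).complex.X i) :=
    (IsProjective.iff_projective _).2 this
  exact hS.map_of_exact (MonoidalCategory.tensorRight ((projectiveResolution M).complex.X i))

/-- The functoriality of `torShortComplex`. -/
noncomputable def torShortComplexMap (M : ModuleCat.{u} R) {S S' : ShortComplex (ModuleCat.{u} R)}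
    (φ : S ⟶ S') : torShortComplex M S ⟶ torShortComplex M S' where
  τ₁ := torComplexMap M φ.τ₁
  τ₂ := torComplexMap M φ.τ₂
  τ₃ := torComplexMap M φ.τ₃
  comm₁₂ := by simp [torShortComplex, ← torComplexMap_comp, φ.comm₁₂]
  comm₂₃ := by simp [torShortComplex, ← torComplexMap_comp, φ.comm₂₃]

lemma torComplex_homology_isZero (M F : ModuleCat.{u} R) [Module.Flat R F] (i : ℕ) :
    Limits.IsZero ((torComplex M F).homology (i + 1)) := by
  have h := (projectiveResolution M).exact_succ i
  rw [← HomologicalComplex.exactAt_iff_isZero_homology]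
  rw [HomologicalComplex.exactAt_iff' (torComplex M F) (i + 2) (i + 1) i (by simp) (by simp)]
  exact Module.Flat.lTensor_shortComplex_exact F
    (ShortComplex.mk ((projectiveResolution M).complex.d (i + 2) (i + 1))
      ((projectiveResolution M).complex.d (i + 1) i) (by simp)) h

/-- `Tor_i(X, M)`, as a functor of `X` for fixed `M`. -/
noncomputable abbrev torObj (M X : ModuleCat.{u} R) (i : ℕ) : ModuleCat.{u} R :=
  (torComplex M X).homology i

noncomputable abbrev torMap (M : ModuleCat.{u} R) {X Y : ModuleCat.{u} R} (f : X ⟶ Y) (i : ℕ) :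
    torObj M X i ⟶ torObj M Y i :=
  HomologicalComplex.homologyMap (torComplexMap M f) i

lemma torMap_id (M X : ModuleCat.{u} R) (i : ℕ) : torMap M (𝟙 X) i = 𝟙 _ := by
  rw [torMap, torComplexMap_id, HomologicalComplex.homologyMap_id]

lemma torMap_zero (M X Y : ModuleCat.{u} R) (i : ℕ) : torMap M (0 : X ⟶ Y) i = 0 := by
  rw [torMap, torComplexMap_zero, HomologicalComplex.homologyMap_zero]

lemma torMap_comp (M : ModuleCat.{u} R) {X Y Z : ModuleCat.{u} R} (f : X ⟶ Y) (g : Y ⟶ Z)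
    (i : ℕ) : torMap M (f ≫ g) i = torMap M f i ≫ torMap M g i := by
  rw [torMap, torComplexMap_comp, HomologicalComplex.homologyMap_comp]

/-- The connecting morphism of the long exact `Tor` sequence. -/
noncomputable def torδ (M : ModuleCat.{u} R) {S : ShortComplex (ModuleCat.{u} R)}
    (hS : S.ShortExact) (i : ℕ) : torObj M S.X₃ (i + 1) ⟶ torObj M S.X₁ i :=
  (torShortComplex_shortExact M hS).δ (i + 1) i rfl

lemma torδ_comp (M : ModuleCat.{u} R) {S : ShortComplex (ModuleCat.{u} R)}
    (hS : S.ShortExact) (i : ℕ) : torδ M hS i ≫ torMap M S.f i = 0 :=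
  (torShortComplex_shortExact M hS).δ_comp (i + 1) i rfl

lemma torδ_naturality (M : ModuleCat.{u} R) {S S' : ShortComplex (ModuleCat.{u} R)}
    (hS : S.ShortExact) (hS' : S'.ShortExact) (φ : S ⟶ S') (i : ℕ) :
    torδ M hS i ≫ torMap M φ.τ₁ i = torMap M φ.τ₃ (i + 1) ≫ torδ M hS' i :=
  HomologicalComplex.HomologySequence.δ_naturality (torShortComplexMap M φ)
    (torShortComplex_shortExact M hS) (torShortComplex_shortExact M hS') (i + 1) i rfl

lemma mono_torδ (M : ModuleCat.{u} R) {S : ShortComplex (ModuleCat.{u} R)}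
    (hS : S.ShortExact) (i : ℕ) (h : torMap M S.g (i + 1) = 0) : Mono (torδ M hS i) :=
  ((torShortComplex_shortExact M hS).homology_exact₃ (i + 1) i rfl).mono_g h

lemma mono_torδ_of_flat (M : ModuleCat.{u} R) {S : ShortComplex (ModuleCat.{u} R)}
    (hS : S.ShortExact) [Module.Flat R S.X₂] (i : ℕ) : Mono (torδ M hS i) :=
  mono_torδ M hS i ((torComplex_homology_isZero M S.X₂ i).eq_of_src _ _)

lemma torMap_eq_zero_of_comp_torδ (M : ModuleCat.{u} R) {S S' : ShortComplex (ModuleCat.{u} R)}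
    (hS : S.ShortExact) (hS' : S'.ShortExact) [Module.Flat R S'.X₂] (φ : S ⟶ S') (i : ℕ)
    (h : torδ M hS i ≫ torMap M φ.τ₁ i = 0) : torMap M φ.τ₃ (i + 1) = 0 := by
  have := mono_torδ_of_flat M hS' i
  rw [← cancel_mono (torδ M hS' i), ← torδ_naturality M hS hS' φ, h, Limits.zero_comp]

lemma epi_torMap_zero (M : ModuleCat.{u} R) {S : ShortComplex (ModuleCat.{u} R)}
    (hS : S.ShortExact) : Epi (torMap M S.g 0) := by
  have h := torShortComplex_shortExact M hS
  have := h.epi_g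
  exact HomologicalComplex.epi_homologyMap_of_epi_of_not_rel (torShortComplex M S).g 0 (by simp)

lemma CategoryTheory.ShortComplex.Exact.module_finite [IsNoetherianRing R]
    {S : ShortComplex (ModuleCat.{u} R)} (hS : S.Exact)
    (h₁ : Module.Finite R S.X₁) (h₃ : Module.Finite R S.X₃) : Module.Finite R S.X₂ := by
  have h := (ShortComplex.ShortExact.moduleCat_exact_iff_function_exact _).1 hS
  have : IsNoetherian R S.X₁ := isNoetherian_of_isNoetherianRing_of_finite R _
  have : IsNoetherian R S.X₃ := isNoetherian_of_isNoetherianRing_of_finite R _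
  have : IsNoetherian R S.X₂ := isNoetherian_of_range_eq_ker S.f.hom S.g.hom
    (LinearMap.exact_iff.1 h).symm
  infer_instance

lemma torObj_finite_of_shortExact [IsNoetherianRing R] (M : ModuleCat.{u} R)
    {S : ShortComplex (ModuleCat.{u} R)} (hS : S.ShortExact) (i : ℕ)
    (h₁ : Module.Finite R (torObj M S.X₁ i)) (h₃ : Module.Finite R (torObj M S.X₃ i)) :
    Module.Finite R (torObj M S.X₂ i) :=
  ((torShortComplex_shortExact M hS).homology_exact₂ i).module_finite h₁ h₃

lemma torObj_zero_finite_of_shortExact (M : ModuleCat.{u} R)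
    {S : ShortComplex (ModuleCat.{u} R)} (hS : S.ShortExact)
    (h₂ : Module.Finite R (torObj M S.X₂ 0)) :
    Module.Finite R (torObj M S.X₃ 0) := by
  have := epi_torMap_zero M hS
  exact Module.Finite.of_surjective _ ((ModuleCat.epi_iff_surjective (torMap M S.g 0)).1 this)

lemma torObj_succ_finite_of_shortExact [IsNoetherianRing R] (M : ModuleCat.{u} R)
    {S : ShortComplex (ModuleCat.{u} R)} (hS : S.ShortExact) (i : ℕ)
    (h₂ : Module.Finite R (torObj M S.X₂ (i + 1))) (h₁ : Module.Finite R (torObj M S.X₁ i)) :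
    Module.Finite R (torObj M S.X₃ (i + 1)) :=
  ((torShortComplex_shortExact M hS).homology_exact₃ (i + 1) i rfl).module_finite h₂ h₁

lemma torObj_finite_of_torMap_eq_zero [IsNoetherianRing R] (M : ModuleCat.{u} R)
    {S : ShortComplex (ModuleCat.{u} R)} (hS : S.ShortExact) (i : ℕ)
    (h : torMap M S.g (i + 1) = 0) (h₁ : Module.Finite R (torObj M S.X₁ i)) :
    Module.Finite R (torObj M S.X₃ (i + 1)) := by
  have := mono_torδ M hS i h
  exact Module.Finite.of_injective _ ((ModuleCat.mono_iff_injective (torδ M hS i)).1 this)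

end TorSequence

section TorFinite

universe u

variable {R : Type u} [CommRing R]

lemma torObj_finite_of_subsingleton (M X : ModuleCat.{u} R) [Subsingleton X] (i : ℕ) :
    Module.Finite R (torObj M X i) := by
  have h : 𝟙 (torObj M X i) = 0 := by
    rw [← torMap_id, (ModuleCat.isZero_of_subsingleton X).eq_of_src (𝟙 X) 0, torMap_zero]
  have : Subsingleton (torObj M X i) :=
    ModuleCat.subsingleton_of_isZero ((Limits.IsZero.iff_id_eq_zero _).2 h)
  infer_instance

lemma torObj_finite_of_iso (M : ModuleCat.{u} R) {X Y : ModuleCat.{u} R} (e : X ≅ Y)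
    (i : ℕ) (h : Module.Finite R (torObj M X i)) : Module.Finite R (torObj M Y i) := by
  have : torMap M e.inv i ≫ torMap M e.hom i = 𝟙 _ := by
    rw [← torMap_comp, e.inv_hom_id, torMap_id]
  refine Module.Finite.of_surjective (torMap M e.hom i).hom fun y ↦ ⟨torMap M e.inv i y, ?_⟩
  exact ConcreteCategory.congr_hom this y

lemma torObj_finite_of_primes [IsNoetherianRing R] (a : Ideal R) (M : ModuleCat.{u} R) (j : ℕ)
    (h : ∀ p : Ideal R, p.IsPrime → a ≤ p → Module.Finite R (torObj M (ModuleCat.of R (R ⧸ p)) j))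
    (N : Type u) [AddCommGroup N] [Module R N] (hN : Module.Finite R N) (m : ℕ)
    (hm : a ^ m ≤ Module.annihilator R N) :
    Module.Finite R (torObj M (ModuleCat.of R N) j) := by
  refine IsNoetherianRing.induction_on_isQuotientEquivQuotientPrime R hN
    (motive := fun N _ _ _ ↦ a ^ m ≤ Module.annihilator R N →
      Module.Finite R (torObj M (ModuleCat.of R N) j)) ?_ ?_ ?_ hm
  · intro N _ _ _ _ _
    exact torObj_finite_of_subsingleton M (ModuleCat.of R N) j
  · intro N _ _ _ p e hm
    rw [e.annihilator_eq, Ideal.annihilator_quotient] at hm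
    exact torObj_finite_of_iso M e.symm.toModuleIso j (h p.1 p.2 (p.2.le_of_pow_le hm))
  · intro N₁ _ _ _ N₂ _ _ _ N₃ _ _ _ f g hf hg hfg h₁ h₃ hm
    have hS := ModuleCat.shortComplex_shortExact
      (ShortComplex.mk (ModuleCat.ofHom f) (ModuleCat.ofHom g)
        (by ext x; exact hfg.apply_apply_eq_zero x)) hfg hf hg
    exact torObj_finite_of_shortExact M hS j
      (h₁ (hm.trans (LinearMap.annihilator_le_of_injective f hf)))
      (h₃ (hm.trans (LinearMap.annihilator_le_of_surjective g hg)))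

/-- If `Tor_j(R/a, M)` is finite for `j ≤ k`, so is `Tor_j(N, M)` for every finite module `N`
killed by a power of `a`. -/
lemma torObj_finite_of_pow_le_annihilator [IsNoetherianRing R] (a : Ideal R)
    (M : ModuleCat.{u} R) (k : ℕ)
    (h : ∀ j ≤ k, Module.Finite R (torObj M (ModuleCat.of R (R ⧸ a)) j)) (j : ℕ)
    (hj : j ≤ k) (N : Type u) [AddCommGroup N] [Module R N] (hN : Module.Finite R N) (m : ℕ)
    (hm : a ^ m ≤ Module.annihilator R N) :
    Module.Finite R (torObj M (ModuleCat.of R N) j) := by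
  induction j generalizing N m with
  | zero =>
    exact torObj_finite_of_primes a M 0 (fun p _ hp ↦ torObj_zero_finite_of_shortExact M
      (LinearMap.shortExact_shortComplexKer (Submodule.factor_surjective hp)) (h 0 hj)) N hN m hm
  | succ j ih =>
    refine torObj_finite_of_primes a M _ (fun p _ hp ↦ torObj_succ_finite_of_shortExact M
      (LinearMap.shortExact_shortComplexKer (Submodule.factor_surjective hp)) j (h _ hj) ?_) N hN
      m hm
    refine ih (by omega) _ inferInstance 1 ?_
    refine (pow_one a).trans_le (Ideal.annihilator_quotient.symm.trans_le ?_)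
    exact LinearMap.annihilator_le_of_injective _ (Submodule.subtype_injective _)

end TorFinite

section ExtTor

universe u

open Abelian

variable {R : Type u} [CommRing R]

/-- Lift a morphism to a morphism from a short complex with projective middle term. -/
lemma CategoryTheory.ShortComplex.ShortExact.exists_hom_of_projective
    {C : Type*} [Category* C] [Abelian C] {S' : ShortComplex C} (hS' : S'.ShortExact)
    (S : ShortComplex C) [Projective S.X₂] (f : S.X₃ ⟶ S'.X₃) :
    ∃ φ : S ⟶ S', φ.τ₃ = f := by
  have := hS'.epi_g
  have := hS'.mono_f
  let g := Projective.factorThru (S.g ≫ f) S'.g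
  have hg : g ≫ S'.g = S.g ≫ f := Projective.factorThru_comp _ _
  exact ⟨{ τ₁ := hS'.exact.lift (S.f ≫ g) (by simp [hg])
           τ₂ := g
           τ₃ := f
           comm₁₂ := by simp
           comm₂₃ := hg }, rfl⟩

/-- A universal class controlling the vanishing of the maps induced on `Tor`. -/
lemma exists_ext_class_controlling_tor [IsNoetherianRing R] (M : ModuleCat.{u} R) (i : ℕ)
    (Y : ModuleCat.{u} R) (hY : Module.Finite R Y) :
    ∃ (Ω : ModuleCat.{u} R) (_ : Module.Finite R Ω) (u : Ext Y Ω (i + 1)),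
      ∀ (X : ModuleCat.{u} R) (f : X ⟶ Y), (Ext.mk₀ f).comp u (zero_add (i + 1)) = 0 →
        torMap M f (i + 1) = 0 := by
  obtain ⟨n, p, hp⟩ := Module.Finite.exists_fin' R Y
  have hS' := LinearMap.shortExact_shortComplexKer hp
  have : Module.Flat R p.shortComplexKer.X₂ := inferInstanceAs (Module.Flat R (Fin n → R))
  have hK : Module.Finite R p.shortComplexKer.X₁ := inferInstanceAs (Module.Finite R p.ker)
  induction i generalizing Y n with
  | zero =>
    refine ⟨p.shortComplexKer.X₁, hK, hS'.extClass, fun X f hf ↦ ?_⟩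
    have hS := X.shortExact_projectiveShortComplex
    obtain ⟨φ, rfl⟩ := hS'.exists_hom_of_projective X.projectiveShortComplex f
    rw [← ShortComplex.ShortExact.extClass_naturality hS hS' φ] at hf
    obtain ⟨x₂, hx₂⟩ := Ext.contravariant_sequence_exact₁ hS _ _ _ hf
    obtain ⟨g, rfl⟩ := (Ext.mk₀_bijective _ _).2 x₂
    rw [Ext.mk₀_comp_mk₀, (Ext.mk₀_bijective _ _).1.eq_iff] at hx₂
    refine torMap_eq_zero_of_comp_torδ M hS hS' φ 0 ?_
    rw [← hx₂, torMap_comp, ← Category.assoc, torδ_comp, Limits.zero_comp]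
  | succ i ih =>
    obtain ⟨m, q, hq⟩ := Module.Finite.exists_fin' R p.shortComplexKer.X₁
    obtain ⟨Ω, hΩ, v, hv⟩ := ih p.shortComplexKer.X₁ hK m q hq
      (LinearMap.shortExact_shortComplexKer hq) (inferInstanceAs (Module.Flat R (Fin m → R)))
      (inferInstanceAs (Module.Finite R q.ker))
    refine ⟨Ω, hΩ, hS'.extClass.comp v (by omega), fun X f hf ↦ ?_⟩
    have hS := X.shortExact_projectiveShortComplex
    obtain ⟨φ, rfl⟩ := hS'.exists_hom_of_projective X.projectiveShortComplex f
    rw [← Ext.comp_assoc _ _ _ (zero_add 1) (by omega) (by omega),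
      ← ShortComplex.ShortExact.extClass_naturality hS hS' φ,
      Ext.comp_assoc _ _ _ (add_zero 1) (zero_add (i + 1)) (by omega)] at hf
    obtain ⟨x₂, hx₂⟩ := Ext.contravariant_sequence_exact₁ hS _ _ _ hf
    rw [Ext.eq_zero_of_projective x₂, Ext.comp_zero] at hx₂
    refine torMap_eq_zero_of_comp_torδ M hS hS' φ (i + 1) ?_
    rw [hv _ _ hx₂.symm, Limits.comp_zero]

end ExtTor

section ExtVanishing

universe u

open Abelian

variable {R : Type u} [CommRing R]

lemma quotient_hom_ext {I : Ideal R} {Z : ModuleCat.{u} R} {f g : ModuleCat.of R (R ⧸ I) ⟶ Z}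
    (h : ∀ y : R, f (Submodule.Quotient.mk (p := I) y) = g (Submodule.Quotient.mk (p := I) y)) :
    f = g := by
  ext : 1
  exact Submodule.linearMap_qext _ (LinearMap.ext h)

/-- The projection `R/I ⟶ R/J` for ideals `I ≤ J`. -/
abbrev quotientProj {I J : Ideal R} (h : I ≤ J) :
    ModuleCat.of R (R ⧸ I) ⟶ ModuleCat.of R (R ⧸ J) :=
  ModuleCat.ofHom (Submodule.factor h)

lemma quotientProj_comp {I J K : Ideal R} (h : I ≤ J) (h' : J ≤ K) :
    quotientProj h ≫ quotientProj h' = quotientProj (h.trans h') := by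
  refine quotient_hom_ext fun x ↦ ?_
  rfl

/-- Every class in `Ext^i(R/a^t, L)` dies in `Ext^i(R/a^s, L)` for some `s`. -/
def ExtPowVanish (a : Ideal R) (L : ModuleCat.{u} R) (i : ℕ) : Prop :=
  ∀ (t : ℕ) (α : Ext (ModuleCat.of R (R ⧸ a ^ t)) L i),
    ∃ (s : ℕ) (h : t ≤ s), (Ext.mk₀ (quotientProj (Ideal.pow_le_pow_right (I := a) h))).comp α
      (zero_add i) = 0

lemma extPowVanish_bot (L : ModuleCat.{u} R) (i : ℕ) : ExtPowVanish (⊥ : Ideal R) L (i + 1) := by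
  intro t α
  refine ⟨t + 1, by omega, ?_⟩
  have h : (⊥ : Ideal R) ^ (t + 1) = ⊥ := by
    rw [← Ideal.zero_eq_bot, zero_pow (by omega)]
  have : Module.Projective R (R ⧸ (⊥ : Ideal R) ^ (t + 1)) :=
    Module.Projective.of_equiv (Submodule.quotEquivOfEqBot _ h).symm
  exact Ext.eq_zero_of_projective _

/-- Multiplication by `x`, from `R/(I : x)` to `R/I`. -/
abbrev mulColon (I : Ideal R) (x : R) :
    ModuleCat.of R (R ⧸ (Submodule.comap (LinearMap.lsmul R R x) I : Ideal R)) ⟶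
      ModuleCat.of R (R ⧸ I) :=
  ModuleCat.ofHom (Submodule.mapQ _ _ (LinearMap.lsmul R R x) le_rfl)

/-- The short complex `R/(I : x) ⟶ R/I ⟶ R/(I + (x))`. -/
abbrev colonShortComplex (I : Ideal R) (x : R) : ShortComplex (ModuleCat.{u} R) :=
  ShortComplex.mk (mulColon I x) (quotientProj (le_sup_left : I ≤ I ⊔ Ideal.span {x})) (by
    refine quotient_hom_ext fun y ↦ ?_
    exact (Submodule.Quotient.mk_eq_zero _).2 (Ideal.mem_sup_right
      (Ideal.mul_mem_right _ _ (Ideal.mem_span_singleton_self x))))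

lemma colonShortComplex_shortExact (I : Ideal R) (x : R) :
    (colonShortComplex I x).ShortExact := by
  apply ModuleCat.shortComplex_shortExact
  · intro y
    obtain ⟨y, rfl⟩ := Submodule.Quotient.mk_surjective _ y
    constructor
    · intro hy
      replace hy : y ∈ I ⊔ Ideal.span {x} := (Submodule.Quotient.mk_eq_zero _).1 hy
      obtain ⟨b, hb, c, hc, rfl⟩ := Submodule.mem_sup.1 hy
      obtain ⟨r, rfl⟩ := Ideal.mem_span_singleton'.1 hc
      refine ⟨Submodule.Quotient.mk r, (Submodule.Quotient.eq _).2 ?_⟩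
      have : LinearMap.lsmul R R x r - (b + r * x) = - b := by
        simp; ring
      rw [this]
      exact I.neg_mem hb
    · rintro ⟨z, hz⟩
      rw [← hz]
      exact ConcreteCategory.congr_hom (colonShortComplex I x).zero z
  · rw [← LinearMap.ker_eq_bot]
    exact Submodule.ker_liftQ_eq_bot _ _ _ (fun y hy ↦ (Submodule.Quotient.mk_eq_zero I).1 hy)
  · exact Submodule.factor_surjective (le_sup_left : I ≤ I ⊔ Ideal.span {x})

/-- The change of ideal in `colonShortComplex`. -/
def colonShortComplexProj {I J : Ideal R} (h : I ≤ J) (x : R) :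
    colonShortComplex I x ⟶ colonShortComplex J x where
  τ₁ := quotientProj (Submodule.comap_mono h)
  τ₂ := quotientProj h
  τ₃ := quotientProj (sup_le_sup_right h _)
  comm₁₂ := by
    refine quotient_hom_ext fun y ↦ ?_
    rfl
  comm₂₃ := by
    refine quotient_hom_ext fun y ↦ ?_
    rfl

lemma Ideal.exists_pow_mul_mem_of_pow_add_mul_mem [IsNoetherianRing R] (I : Ideal R) (x : R)
    (t : ℕ) : ∃ k, ∀ y, x ^ (t + k) * y ∈ I → x ^ k * y ∈ I := by
  let f : ℕ →o Ideal R :=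
    { toFun k := Submodule.comap (LinearMap.lsmul R R (x ^ k)) I
      monotone' := by
        intro k l hkl y hy
        obtain ⟨m, rfl⟩ := Nat.exists_eq_add_of_le hkl
        have := I.mul_mem_left (x ^ m) (show x ^ k * y ∈ I from hy)
        change x ^ (k + m) * y ∈ I
        convert this using 1
        ring }
  obtain ⟨k, hk⟩ := monotone_stabilizes_iff_noetherian.2 ‹_› f
  refine ⟨k, fun y hy ↦ ?_⟩
  have h : y ∈ f (t + k) := hy
  rw [← hk (t + k) (by omega)] at h
  exact h

/-- The change of exponent in `colonShortComplex`. -/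
def colonShortComplexPow (I : Ideal R) (x : R) (t k : ℕ) :
    colonShortComplex I (x ^ (t + k)) ⟶ colonShortComplex I (x ^ t) where
  τ₁ := ModuleCat.ofHom (Submodule.mapQ _ _ (LinearMap.lsmul R R (x ^ k)) (by
    intro y hy
    replace hy : x ^ (t + k) * y ∈ I := hy
    change x ^ t * (x ^ k * y) ∈ I
    rwa [← mul_assoc, ← pow_add]))
  τ₂ := 𝟙 _
  τ₃ := quotientProj (sup_le_sup_left
    (Ideal.span_singleton_le_span_singleton.2 (pow_dvd_pow x (by omega))) _)
  comm₁₂ := by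
    refine quotient_hom_ext fun y ↦ ?_
    refine congrArg (Submodule.Quotient.mk (p := I)) ?_
    change x ^ t * (x ^ k * y) = x ^ (t + k) * y
    ring
  comm₂₃ := by
    refine quotient_hom_ext fun y ↦ ?_
    rfl

lemma ExtPowVanish.sup_span_singleton [IsNoetherianRing R] {b : Ideal R} {L : ModuleCat.{u} R}
    {j : ℕ} (hb : ExtPowVanish b L j) (hb' : ExtPowVanish b L (j + 1)) (x : R) :
    ExtPowVanish (b ⊔ Ideal.span {x}) L (j + 1) := by
  intro t α₀
  have h₀ : b ^ t ⊔ Ideal.span {x ^ t} ≤ (b ⊔ Ideal.span {x}) ^ t :=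
    sup_le (Ideal.pow_right_mono le_sup_left t) (by
      rw [← Ideal.span_singleton_pow]
      exact Ideal.pow_right_mono le_sup_right t)
  obtain ⟨α, hα⟩ : ∃ α, α = (Ext.mk₀ (quotientProj h₀)).comp α₀ (zero_add (j + 1)) := ⟨_, rfl⟩
  obtain ⟨t₁, h₁, hα₁⟩ := hb' t
    ((Ext.mk₀ (colonShortComplex (b ^ t) (x ^ t)).g).comp α (zero_add _))
  have h₁' := Ideal.pow_le_pow_right (I := b) h₁
  obtain ⟨β, hβ⟩ := Ext.contravariant_sequence_exact₃
    (colonShortComplex_shortExact (b ^ t₁) (x ^ t)) L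
    ((Ext.mk₀ (colonShortComplexProj h₁' (x ^ t)).τ₃).comp α (zero_add _)) (by
      rw [← hα₁, Ext.mk₀_comp_mk₀_assoc, Ext.mk₀_comp_mk₀_assoc]
      congr 2
      exact (colonShortComplexProj h₁' (x ^ t)).comm₂₃.symm) (add_comm 1 j)
  have hI (I : Ideal R) : I ≤ Submodule.comap (LinearMap.lsmul R R (x ^ t)) I :=
    fun y hy ↦ I.mul_mem_left (x ^ t) hy
  obtain ⟨t₂, h₂, hβ₂⟩ := hb t₁ ((Ext.mk₀ (quotientProj (hI _))).comp β (zero_add _))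
  have h₂' := Ideal.pow_le_pow_right (I := b) h₂
  obtain ⟨k, hk⟩ := Ideal.exists_pow_mul_mem_of_pow_add_mul_mem (b ^ t₂) x t
  let φ := colonShortComplexPow (b ^ t₂) x t k ≫ colonShortComplexProj h₂' (x ^ t)
  have hφ : (Ext.mk₀ φ.τ₁).comp β (zero_add j) = 0 := by
    have : φ.τ₁ = ModuleCat.ofHom (Submodule.mapQ
        (Submodule.comap (LinearMap.lsmul R R (x ^ (t + k))) (b ^ t₂)) (b ^ t₂)
        (LinearMap.lsmul R R (x ^ k)) hk) ≫ quotientProj h₂' ≫ quotientProj (hI (b ^ t₁)) :=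
      quotient_hom_ext fun _ ↦ rfl
    rw [this, ← Ext.mk₀_comp_mk₀_assoc, ← Ext.mk₀_comp_mk₀_assoc, hβ₂, Ext.comp_zero]
  have hle : (b ⊔ Ideal.span {x}) ^ (t₂ + (t + k)) ≤ b ^ t₂ ⊔ Ideal.span {x ^ (t + k)} := by
    rw [← Ideal.span_singleton_pow]
    exact Ideal.sup_pow_add_le_pow_sup_pow
  refine ⟨t₂ + (t + k), by omega, ?_⟩
  have hproj : quotientProj (Ideal.pow_le_pow_right (I := b ⊔ Ideal.span {x})
      (show t ≤ t₂ + (t + k) by omega)) = quotientProj hle ≫ φ.τ₃ ≫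
        (colonShortComplexProj h₁' (x ^ t)).τ₃ ≫ quotientProj h₀ :=
    quotient_hom_ext fun _ ↦ rfl
  rw [hproj, ← Ext.mk₀_comp_mk₀_assoc, ← Ext.mk₀_comp_mk₀_assoc, ← Ext.mk₀_comp_mk₀_assoc, ← hα,
    ← hβ, ← Ext.comp_assoc _ _ _ (zero_add 1) (add_comm 1 j) (by omega),
    ← ShortComplex.ShortExact.extClass_naturality (colonShortComplex_shortExact _ _)
      (colonShortComplex_shortExact _ _) φ,
    Ext.comp_assoc _ _ _ (add_zero 1) (zero_add j) (by omega), hφ, Ext.comp_zero, Ext.comp_zero]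

/-- The cohomological dimension is at most the number of generators. -/
lemma extPowVanish_span_finset [IsNoetherianRing R] (s : Finset R) (L : ModuleCat.{u} R) (i : ℕ)
    (hi : s.card < i) : ExtPowVanish (Ideal.span (s : Set R)) L i := by
  classical
  obtain ⟨i, rfl⟩ := Nat.exists_eq_add_of_lt (Nat.zero_lt_of_lt hi)
  rw [zero_add] at hi ⊢
  induction s using Finset.induction_on generalizing i with
  | empty => simpa using extPowVanish_bot L i
  | insert x s hx ih =>
    rw [Finset.card_insert_of_notMem hx] at hi
    rw [Finset.coe_insert, Ideal.span_insert, sup_comm]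
    obtain ⟨j, rfl⟩ := Nat.exists_eq_add_of_lt (show 0 < i by omega)
    rw [zero_add] at hi ⊢
    exact (ih j (by omega)).sup_span_singleton (ih (j + 1) (by omega)) x

lemma exists_forall_extPowVanish [IsNoetherianRing R] (a : Ideal R) :
    ∃ n, ∀ (L : ModuleCat.{u} R) (i : ℕ), n < i → ExtPowVanish a L i := by
  obtain ⟨s, rfl⟩ := (isNoetherianRing_iff_ideal_fg R).1 ‹_› a
  exact ⟨s.card, fun L i hi ↦ extPowVanish_span_finset s L i hi⟩

end ExtVanishing

section ExtDescent

universe u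

open Abelian

variable {R : Type u} [CommRing R]

lemma ExtPowVanish.of_shortExact {a : Ideal R} {S : ShortComplex (ModuleCat.{u} R)}
    (hS : S.ShortExact) {i : ℕ} (h₂ : ExtPowVanish a S.X₂ i) (h₁ : ExtPowVanish a S.X₁ (i + 1)) :
    ExtPowVanish a S.X₃ i := by
  intro t α
  obtain ⟨s, hs, hα⟩ := h₁ t (α.comp hS.extClass rfl)
  rw [← Ext.comp_assoc _ _ _ (zero_add i) rfl (zero_add (i + 1))] at hα
  obtain ⟨β, hβ⟩ := Ext.covariant_sequence_exact₃ _ hS _ rfl hα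
  obtain ⟨r, hr, hβ'⟩ := h₂ s β
  refine ⟨r, hs.trans hr, ?_⟩
  rw [← quotientProj_comp (Ideal.pow_le_pow_right hr) (Ideal.pow_le_pow_right hs),
    ← Ext.mk₀_comp_mk₀_assoc, ← hβ,
    ← Ext.comp_assoc _ _ _ (zero_add i) (add_zero i) (by omega), hβ', Ext.zero_comp]

lemma ExtPowVanish.pi {a : Ideal R} {i : ℕ} (h : ExtPowVanish a (ModuleCat.of R R) i) (m : ℕ) :
    ExtPowVanish a (ModuleCat.of R (Fin m → R)) i := by
  intro t α
  choose s hs hα using fun j : Fin m ↦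
    h t (α.comp (Ext.mk₀ (ModuleCat.ofHom (LinearMap.proj j))) (add_zero i))
  have hr (j : Fin m) : s j ≤ t + ∑ j, s j :=
    (Finset.single_le_sum (fun _ _ ↦ Nat.zero_le _) (Finset.mem_univ j)).trans (by omega)
  refine ⟨t + ∑ j, s j, by omega, ?_⟩
  have hid : 𝟙 (ModuleCat.of R (Fin m → R)) =
      ∑ j, ModuleCat.ofHom (LinearMap.proj j) ≫
        ModuleCat.ofHom (LinearMap.single R (fun _ ↦ R) j) := by
    ext : 1
    refine LinearMap.ext fun v ↦ ?_
    rw [ModuleCat.hom_sum]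
    simpa using (LinearMap.sum_single_apply (fun _ : Fin m ↦ R) v).symm
  rw [← Ext.comp_mk₀_id (Ext.comp _ _ _), hid, Ext.mk₀_sum, Ext.comp_sum]
  refine Finset.sum_eq_zero fun j _ ↦ ?_
  rw [← Ext.mk₀_comp_mk₀, ← Ext.comp_assoc _ _ _ (add_zero i) (add_zero 0) (by omega),
    ← quotientProj_comp (Ideal.pow_le_pow_right (hr j)) (Ideal.pow_le_pow_right (hs j)),
    Ext.comp_assoc _ _ _ (zero_add i) (add_zero i) (by omega),
    ← Ext.mk₀_comp_mk₀_assoc, hα, Ext.comp_zero, Ext.zero_comp]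

lemma ExtPowVanish.of_finite [IsNoetherianRing R] {a : Ideal R} {c : ℕ}
    (h : ∀ i, c < i → ExtPowVanish a (ModuleCat.of R R) i) (i : ℕ) (hi : c < i)
    (L : ModuleCat.{u} R) (hL : Module.Finite R L) : ExtPowVanish a L i := by
  obtain ⟨n, hn⟩ := exists_forall_extPowVanish a
  obtain ⟨k, hk⟩ : ∃ k, n < i + k := ⟨n + 1, by omega⟩
  induction k generalizing i L with
  | zero => exact hn L i hk
  | succ k ih =>
    obtain ⟨m, p, hp⟩ := Module.Finite.exists_fin' R L
    exact ExtPowVanish.of_shortExact (LinearMap.shortExact_shortComplexKer hp) ((h i hi).pi m)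
      (ih (i + 1) (by omega) _ (inferInstanceAs (Module.Finite R p.ker)) (by omega))

lemma torObj_finite_of_extPowVanish [IsNoetherianRing R] (a : Ideal R) (M : ModuleCat.{u} R)
    (c : ℕ) (hc : ∀ i, c < i → ExtPowVanish a (ModuleCat.of R R) i)
    (h : ∀ i ≤ c, Module.Finite R (torObj M (ModuleCat.of R (R ⧸ a)) i)) (i : ℕ) :
    Module.Finite R (torObj M (ModuleCat.of R (R ⧸ a)) i) := by
  induction i using Nat.strong_induction_on with | _ i ih =>
  by_cases hi : i ≤ c
  · exact h i hi
  obtain ⟨k, rfl⟩ := Nat.exists_eq_add_of_lt (Nat.zero_lt_of_lt (not_le.1 hi))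
  rw [zero_add] at *
  obtain ⟨Ω, hΩ, v, hv⟩ := exists_ext_class_controlling_tor M k (ModuleCat.of R (R ⧸ a))
    inferInstance
  obtain ⟨s, hs, hvs⟩ := ExtPowVanish.of_finite hc (k + 1) (not_le.1 hi) Ω hΩ 1
    ((Ext.mk₀ (quotientProj (pow_one a).le)).comp v (zero_add _))
  rw [Ext.mk₀_comp_mk₀_assoc, quotientProj_comp] at hvs
  refine torObj_finite_of_torMap_eq_zero M (LinearMap.shortExact_shortComplexKer
    (Submodule.factor_surjective ((Ideal.pow_le_pow_right hs).trans (pow_one a).le))) k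
    (hv _ _ hvs) ?_
  refine torObj_finite_of_pow_le_annihilator a M k (fun j hj ↦ ih j (by omega)) k le_rfl _
    inferInstance s ?_
  exact Ideal.annihilator_quotient.symm.trans_le
    (LinearMap.annihilator_le_of_injective _ (Submodule.subtype_injective _))

end ExtDescent

section OppositeComplex

universe v u

open Opposite

variable {R : Type u} [CommRing R] (K : ChainComplex (ModuleCat.{v} R)ᵒᵖ ℕ) (n : ℕ)

/-- The element `x` of the cohomology of the cochain complex of modules opposite to `K` is
represented by the cocycle `z`. -/
def IsRepresentative (z : (K.X n).unop) (x : (K.homology n).unop) : Prop :=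
  ∃ w : (K.opcycles n).unop, (K.pOpcycles n).unop w = z ∧ (K.homologyι n).unop w = x

variable {K n}

lemma IsRepresentative.d_eq_zero {z : (K.X n).unop} {x : (K.homology n).unop}
    (h : IsRepresentative K n z x) (m : ℕ) : (K.d m n).unop z = 0 := by
  obtain ⟨w, rfl, -⟩ := h
  rw [← ConcreteCategory.comp_apply, ← unop_comp, K.d_pOpcycles]
  rfl

lemma exists_isRepresentative_of_d_eq_zero {z : (K.X n).unop}
    (hz : (K.d (n + 1) n).unop z = 0) : ∃ x, IsRepresentative K n z x := by
  have h := (ShortComplex.ShortExact.moduleCat_exact_iff_function_exact _).1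
    (ShortComplex.exact_of_g_is_cokernel
      (ShortComplex.mk _ _ (K.d_pOpcycles (n + 1) n))
      (K.opcyclesIsCokernel (n + 1) n (by simp))).unop
  obtain ⟨w, hw⟩ := (h z).1 hz
  exact ⟨_, w, hw, rfl⟩

variable (K n) in
lemma exists_isRepresentative (x : (K.homology n).unop) : ∃ z, IsRepresentative K n z x := by
  obtain ⟨w, rfl⟩ := (ModuleCat.epi_iff_surjective (K.homologyι n).unop).1 inferInstance x
  exact ⟨_, w, rfl, rfl⟩

lemma IsRepresentative.eq_zero_iff {p : ℕ} {z : (K.X (p + 1)).unop}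
    {x : (K.homology (p + 1)).unop} (h : IsRepresentative K (p + 1) z x) :
    x = 0 ↔ ∃ g : (K.X p).unop, (K.d (p + 1) p).unop g = z := by
  obtain ⟨w, rfl, rfl⟩ := h
  have h := (ShortComplex.ShortExact.moduleCat_exact_iff_function_exact _).1
    (ShortComplex.exact_of_f_is_kernel
      (ShortComplex.mk _ _ (K.homologyι_comp_fromOpcycles (p + 1) p))
      (K.homologyIsKernel (p + 1) p (by simp))).unop
  refine (h w).trans (exists_congr fun g ↦ ?_)
  rw [← K.p_fromOpcycles (p + 1) p, unop_comp]
  exact ((ModuleCat.mono_iff_injective (K.pOpcycles (p + 1)).unop).1 inferInstance).eq_iff.symm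

lemma IsRepresentative.map {L : ChainComplex (ModuleCat.{v} R)ᵒᵖ ℕ} (φ : L ⟶ K)
    {z : (K.X n).unop} {x : (K.homology n).unop} (h : IsRepresentative K n z x) :
    IsRepresentative L n ((φ.f n).unop z)
      ((HomologicalComplex.homologyMap φ n).unop x) := by
  obtain ⟨w, rfl, rfl⟩ := h
  refine ⟨(HomologicalComplex.opcyclesMap φ n).unop w, ?_, ?_⟩
  · rw [← ConcreteCategory.comp_apply, ← ConcreteCategory.comp_apply, ← unop_comp, ← unop_comp,
      HomologicalComplex.p_opcyclesMap]
  · rw [← ConcreteCategory.comp_apply, ← ConcreteCategory.comp_apply, ← unop_comp, ← unop_comp,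
      HomologicalComplex.homologyι_naturality]

end OppositeComplex

section ExtComparison

universe u

open Opposite

variable {R : Type u} [CommRing R]

variable (Y : ModuleCat.{u} R)

/-- The complex of modules opposite to the cochain complex `Hom(C, Y)`. -/
noncomputable abbrev opHomComplex (C : ChainComplex (ModuleCat.{u} R) ℕ) :
    ChainComplex (ModuleCat.{u} R)ᵒᵖ ℕ :=
  (((linearYoneda R (ModuleCat.{u} R)).obj Y).rightOp.mapHomologicalComplex _).obj C

/-- The elements `x` and `α` of the two models of `Ext^n(X, Y)` have a common representative. -/
def ExtRel (n : ℕ) (X : ModuleCat.{u} R) (x : ((Ext R (ModuleCat.{u} R) n).obj (op X)).obj Y)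
    (α : Abelian.Ext X Y n) : Prop :=
  ∃ (f : (projectiveResolution X).complex.X n ⟶ Y)
    (hf : (projectiveResolution X).complex.d (n + 1) n ≫ f = 0)
    (y : ((opHomComplex Y (projectiveResolution X).complex).homology n).unop),
    IsRepresentative _ n f y ∧
    ((projectiveResolution X).isoLeftDerivedObj
      ((linearYoneda R (ModuleCat.{u} R)).obj Y).rightOp n).hom.unop y = x ∧
    (projectiveResolution X).extMk f (n + 1) rfl hf = α

variable {Y} {n : ℕ} {X : ModuleCat.{u} R}

lemma exists_extRel_left (x : ((Ext R (ModuleCat.{u} R) n).obj (op X)).obj Y) :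
    ∃ α, ExtRel Y n X x α := by
  let e := (projectiveResolution X).isoLeftDerivedObj
      ((linearYoneda R (ModuleCat.{u} R)).obj Y).rightOp n
  obtain ⟨y, hy⟩ := (ModuleCat.epi_iff_surjective e.hom.unop).1 inferInstance x
  obtain ⟨f, hf⟩ := exists_isRepresentative _ n y
  exact ⟨_, f, hf.d_eq_zero _, y, hf, hy, rfl⟩

lemma exists_extRel_right (α : Abelian.Ext X Y n) : ∃ x, ExtRel Y n X x α := by
  obtain ⟨f, hf, rfl⟩ := (projectiveResolution X).extMk_surjective α (n + 1) rfl
  obtain ⟨y, hy⟩ := exists_isRepresentative_of_d_eq_zero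
    (K := opHomComplex Y (projectiveResolution X).complex) (z := f) hf
  exact ⟨_, f, hf, y, hy, rfl, rfl⟩

lemma ExtRel.eq_zero_iff {p : ℕ} {x : ((Ext R (ModuleCat.{u} R) (p + 1)).obj (op X)).obj Y}
    {α : Abelian.Ext X Y (p + 1)} (h : ExtRel Y (p + 1) X x α) : x = 0 ↔ α = 0 := by
  obtain ⟨f, hf, y, hy, rfl, rfl⟩ := h
  rw [ProjectiveResolution.extMk_eq_zero_iff _ _ _ _ _ p rfl]
  refine Iff.trans ?_ hy.eq_zero_iff
  exact map_eq_zero_iff _ ((ModuleCat.mono_iff_injective _).1 inferInstance)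

lemma ExtRel.map {x : ((Ext R (ModuleCat.{u} R) n).obj (op X)).obj Y}
    {α : Abelian.Ext X Y n} (h : ExtRel Y n X x α) {X' : ModuleCat.{u} R} (g : X' ⟶ X) :
    ExtRel Y n X' ((((Ext R (ModuleCat.{u} R) n).map g.op).app Y) x)
      ((Abelian.Ext.mk₀ g).comp α (zero_add n)) := by
  obtain ⟨f, hf, y, hy, rfl, rfl⟩ := h
  let φ : ProjectiveResolution.Hom (projectiveResolution X') (projectiveResolution X) g :=
    { hom := ProjectiveResolution.lift g _ _
      hom_f_zero_comp_π_f_zero := ProjectiveResolution.lift_commutes_zero g _ _ }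
  refine ⟨φ.hom.f n ≫ f, by simp [← φ.hom.comm_assoc, hf], _, hy.map
    ((((linearYoneda R (ModuleCat.{u} R)).obj Y).rightOp.mapHomologicalComplex _).map φ.hom),
    ?_, (ProjectiveResolution.mk₀_comp_extMk f _ rfl hf φ).symm⟩
  have h := congrArg Quiver.Hom.unop
    (ProjectiveResolution.isoLeftDerivedObj_hom_naturality g
      (projectiveResolution X') (projectiveResolution X) φ.hom φ.hom_f_zero_comp_π_f_zero
      ((linearYoneda R (ModuleCat.{u} R)).obj Y).rightOp n)
  exact (ConcreteCategory.congr_hom h y).symm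

end ExtComparison

section LocalCohomologyComparison

universe u

open Opposite Limits

variable {R : Type u} [CommRing R]

lemma subsingleton_localCohomology_obj_iff (a : Ideal R) (i : ℕ) (L : ModuleCat.{u} R) :
    Subsingleton ((localCohomology a i).obj L) ↔
      ∀ (t : ℕ) (x : ((Ext R (ModuleCat.{u} R) i).obj (op (ModuleCat.of R (R ⧸ a ^ t)))).obj L),
        ∃ (s : ℕ) (h : t ≤ s), ((Ext R (ModuleCat.{u} R) i).map
          (quotientProj (Ideal.pow_le_pow_right (I := a) h)).op).app L x = 0 := by
  let D := localCohomology.diagram (localCohomology.idealPowersDiagram a) i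
  have : HasColimit D := localCohomology.hasColimitDiagram.{u, 0} _ _
  let F := D ⋙ (evaluation _ _).obj L
  have hc := isColimitOfPreserves ((evaluation _ _).obj L) (colimit.isColimit D)
  have := preservesFilteredColimitsOfSize_shrink.{0, u, 0, u} (forget (ModuleCat.{u} R))
  constructor
  · intro hs t x
    obtain ⟨k, f, g, hk⟩ := Concrete.isColimit_exists_of_rep_eq F hc (i := op (op t))
      (j := op (op t)) x 0 (hs.elim _ _)
    refine ⟨k.unop.unop, f.unop.unop.le, hk.trans (map_zero _)⟩
  · intro h
    refine subsingleton_of_forall_eq 0 fun y ↦ ?_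
    obtain ⟨j, x, rfl⟩ := Concrete.isColimit_exists_rep F hc y
    obtain ⟨s, hs, hx⟩ := h j.unop.unop x
    let f : j ⟶ op (op s) := (homOfLE hs).op.op
    exact (Concrete.isColimit_rep_eq_of_exists F (i := j) (j := op (op s)) x 0
      ⟨op (op s), f, 𝟙 _, hx.trans (map_zero _).symm⟩).trans (map_zero _)

lemma extPowVanish_iff_subsingleton_localCohomology (a : Ideal R) (p : ℕ) (L : ModuleCat.{u} R) :
    ExtPowVanish a L (p + 1) ↔ Subsingleton ((localCohomology a (p + 1)).obj L) := by
  rw [subsingleton_localCohomology_obj_iff]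
  refine forall_congr' fun t ↦ ⟨fun h x ↦ ?_, fun h α ↦ ?_⟩
  · obtain ⟨α, hα⟩ := exists_extRel_left x
    obtain ⟨s, hs, h0⟩ := h α
    exact ⟨s, hs, (hα.map _).eq_zero_iff.2 h0⟩
  · obtain ⟨x, hx⟩ := exists_extRel_right α
    obtain ⟨s, hs, h0⟩ := h x
    exact ⟨s, hs, (hx.map _).eq_zero_iff.1 h0⟩

lemma extPowVanish_of_sSup_lt [IsNoetherianRing R] (a : Ideal R) (i : ℕ)
    (hi : sSup {i : ℕ | Nontrivial ((localCohomology a i).obj (ModuleCat.of R R))} < i) :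
    ExtPowVanish a (ModuleCat.of R R) i := by
  obtain ⟨p, rfl⟩ := Nat.exists_eq_add_of_lt (Nat.zero_lt_of_lt hi)
  rw [zero_add] at *
  obtain ⟨n, hn⟩ := exists_forall_extPowVanish a
  rw [extPowVanish_iff_subsingleton_localCohomology, ← not_nontrivial_iff_subsingleton]
  refine fun h ↦ hi.not_ge (le_csSup ⟨n, fun j hj ↦ ?_⟩ h)
  by_contra! hlt
  obtain ⟨q, rfl⟩ := Nat.exists_eq_add_of_lt (Nat.zero_lt_of_lt hlt)
  rw [zero_add] at *
  exact not_nontrivial_iff_subsingleton.2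
    ((extPowVanish_iff_subsingleton_localCohomology _ _ _).1 (hn _ _ hlt)) hj

end LocalCohomologyComparison

/-- If `c = cd(a, R)` is the cohomological dimension of `R` with respect to `a` and
`Tor_i(R/a, M)` is finitely generated for every `0 ≤ i ≤ c`, then `Tor_i(R/a, M)` is
finitely generated for every `i ≥ 0`. -/
theorem tor_finite_of_tor_finite_up_to_cd
    {R : Type u} [CommRing R] [IsNoetherianRing R] (a : Ideal R)
    (M : Type u) [AddCommGroup M] [Module R M]
    (c : ℕ)
    (hc : c = sSup {i : ℕ | Nontrivial ((localCohomology a i).obj (ModuleCat.of R R))})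
    (h : ∀ i : ℕ, i ≤ c → Module.Finite R
      (((Tor (ModuleCat.{u} R) i).obj (ModuleCat.of R (R ⧸ a))).obj (ModuleCat.of R M)))
    (i : ℕ) :
    Module.Finite R
      (((Tor (ModuleCat.{u} R) i).obj (ModuleCat.of R (R ⧸ a))).obj (ModuleCat.of R M)) := by
  have e (j : ℕ) := (torIso (ModuleCat.of R M) (ModuleCat.of R (R ⧸ a)) j).toLinearEquiv
  have := torObj_finite_of_extPowVanish a (ModuleCat.of R M) c
    (fun j hj ↦ extPowVanish_of_sSup_lt a j (hc ▸ hj))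
    (fun j hj ↦ have := h j hj; Module.Finite.equiv (e j)) i
  exact Module.Finite.equiv (e i).symm
end

section
/- Let R be a commutative noetherian ring with unity, let a be an ideal of R generated by n elements, and let M be an R-module. If Tor^R_i(R/a, M) is a finitely generated R-module for every 0 ≤ i ≤ n, then Tor^R_i(R/a, M) is a finitely generated R-module for every i ≥ 0. -/
open CategoryTheory

namespace ModuleCat

variable {R : Type u} [CommRing R]

/-- Tensoring a short exact sequence with a complex of projective modules gives a short exact
sequence of complexes. -/
theorem shortExact_tensoringLeft_mapHomologicalComplex {S : ShortComplex (ModuleCat.{u} R)}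
    (hS : S.ShortExact) (K : ChainComplex (ModuleCat.{u} R) ℕ) [∀ i, Projective (K.X i)] :
    (ShortComplex.mk
      ((NatTrans.mapHomologicalComplex
        ((MonoidalCategory.tensoringLeft (ModuleCat.{u} R)).map S.f) _).app K)
      ((NatTrans.mapHomologicalComplex
        ((MonoidalCategory.tensoringLeft (ModuleCat.{u} R)).map S.g) _).app K)
      (by
        rw [← NatTrans.comp_app, ← NatTrans.mapHomologicalComplex_comp, ← Functor.map_comp,
          S.zero]
        ext i : 1
        simp
        rfl)).ShortExact := by
  apply HomologicalComplex.shortExact_of_degreewise_shortExact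
  intro i
  have : Module.Projective R (K.X i) := (K.X i).projective_of_module_projective
  have hf := (mono_iff_injective _).1 hS.mono_f
  have hg := (epi_iff_surjective _).1 hS.epi_g
  have he := (ShortComplex.ShortExact.moduleCat_exact_iff_function_exact S).1 hS.exact
  exact
    { exact := (ShortComplex.ShortExact.moduleCat_exact_iff_function_exact _).2
        (rTensor_exact (K.X i) he hg)
      mono_f := (mono_iff_injective _).2
        (Module.Flat.rTensor_preserves_injective_linearMap (M := K.X i) S.f.hom hf)
      epi_g := (epi_iff_surjective _).2 (LinearMap.rTensor_surjective (K.X i) hg) }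

theorem finite_of_exact [IsNoetherianRing R] {S : ShortComplex (ModuleCat.{u} R)} (hS : S.Exact)
    (h₁ : Module.Finite R S.X₁) (h₃ : Module.Finite R S.X₃) : Module.Finite R S.X₂ := by
  have : IsNoetherian R S.X₁ := isNoetherian_of_isNoetherianRing_of_finite R _
  have : IsNoetherian R S.X₃ := isNoetherian_of_isNoetherianRing_of_finite R _
  have := isNoetherian_of_range_eq_ker S.f.hom S.g.hom hS.moduleCat_range_eq_ker
  infer_instance

theorem homology_finite_of_subsingleton (K : ChainComplex (ModuleCat.{u} R) ℕ) (k : ℕ)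
    (h : Subsingleton (K.X k)) : Module.Finite R (K.homology k) := by
  have hK : K.ExactAt k :=
    ShortComplex.exact_of_isZero_X₂ (K.sc k) (isZero_of_subsingleton (K.X k))
  have := subsingleton_of_isZero hK.isZero_homology
  infer_instance

section Tor

variable (M : ModuleCat.{u} R)

theorem tor_finite_iff (N : ModuleCat.{u} R) (k : ℕ) :
    Module.Finite R (((Tor (ModuleCat.{u} R) k).obj N).obj M) ↔
      Module.Finite R (((((MonoidalCategory.tensoringLeft (ModuleCat.{u} R)).obj
        N).mapHomologicalComplex _).obj (CategoryTheory.projectiveResolution M).complex).homology k) :=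
  Module.Finite.equiv_iff
    ((CategoryTheory.projectiveResolution M).isoLeftDerivedObj
      ((MonoidalCategory.tensoringLeft (ModuleCat.{u} R)).obj N) k).toLinearEquiv

theorem subsingleton_tor_succ_of_flat (F : ModuleCat.{u} R) [Module.Flat R F] (k : ℕ) :
    Subsingleton (((Tor (ModuleCat.{u} R) (k + 1)).obj F).obj M) := by
  refine subsingleton_of_isZero (Limits.IsZero.of_iso ?_
    ((CategoryTheory.projectiveResolution M).isoLeftDerivedObj
      ((MonoidalCategory.tensoringLeft (ModuleCat.{u} R)).obj F) (k + 1)))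
  refine HomologicalComplex.ExactAt.isZero_homology ?_
  rw [HomologicalComplex.exactAt_iff' _ (k + 2) (k + 1) k (by simp) (by simp)]
  exact (ShortComplex.ShortExact.moduleCat_exact_iff_function_exact _).2
    (Module.Flat.lTensor_exact F ((ShortComplex.ShortExact.moduleCat_exact_iff_function_exact _).1
      ((CategoryTheory.projectiveResolution M).exact_succ k)))

variable {S : ShortComplex (ModuleCat.{u} R)}

theorem tor_finite_X₂ [IsNoetherianRing R] (hS : S.ShortExact) (k : ℕ)
    (h₁ : Module.Finite R (((Tor (ModuleCat.{u} R) k).obj S.X₁).obj M))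
    (h₃ : Module.Finite R (((Tor (ModuleCat.{u} R) k).obj S.X₃).obj M)) :
    Module.Finite R (((Tor (ModuleCat.{u} R) k).obj S.X₂).obj M) := by
  rw [tor_finite_iff] at *
  exact finite_of_exact ((shortExact_tensoringLeft_mapHomologicalComplex hS
    (CategoryTheory.projectiveResolution M).complex).homology_exact₂ k) h₁ h₃

theorem tor_succ_finite_X₃ [IsNoetherianRing R] (hS : S.ShortExact) (k : ℕ)
    (h₂ : Module.Finite R (((Tor (ModuleCat.{u} R) (k + 1)).obj S.X₂).obj M))
    (h₁ : Module.Finite R (((Tor (ModuleCat.{u} R) k).obj S.X₁).obj M)) :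
    Module.Finite R (((Tor (ModuleCat.{u} R) (k + 1)).obj S.X₃).obj M) := by
  rw [tor_finite_iff] at *
  exact finite_of_exact ((shortExact_tensoringLeft_mapHomologicalComplex hS
    (CategoryTheory.projectiveResolution M).complex).homology_exact₃ (k + 1) k (by simp)) h₂ h₁

theorem tor_zero_finite_X₃ (hS : S.ShortExact)
    (h₂ : Module.Finite R (((Tor (ModuleCat.{u} R) 0).obj S.X₂).obj M)) :
    Module.Finite R (((Tor (ModuleCat.{u} R) 0).obj S.X₃).obj M) := by
  rw [tor_finite_iff] at *
  have h := shortExact_tensoringLeft_mapHomologicalComplex hS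
    (CategoryTheory.projectiveResolution M).complex
  have := h.epi_g
  have hepi := HomologicalComplex.epi_homologyMap_of_epi_of_not_rel
    ((NatTrans.mapHomologicalComplex
      ((MonoidalCategory.tensoringLeft (ModuleCat.{u} R)).map S.g) _).app
        (CategoryTheory.projectiveResolution M).complex) 0 (by simp)
  exact Module.Finite.of_surjective _ ((epi_iff_surjective _).1 hepi)

end Tor

end ModuleCat

namespace ExteriorAlgebra

variable {R V : Type*} [CommRing R] [AddCommGroup V] [Module R V] (f : Module.Dual R V)

/-- The differential of the Koszul complex of a linear form, on the whole exterior algebra. -/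
noncomputable def koszulD : ExteriorAlgebra R V →ₗ[R] ExteriorAlgebra R V :=
  CliffordAlgebra.contractLeft (Q := (0 : QuadraticForm R V)) f

theorem koszulD_ι_mul (v : V) (x : ExteriorAlgebra R V) :
    koszulD f (ι R v * x) = f v • x - ι R v * koszulD f x :=
  CliffordAlgebra.contractLeft_ι_mul ..

theorem koszulD_ι (v : V) : koszulD f (ι R v) = algebraMap R _ (f v) :=
  CliffordAlgebra.contractLeft_ι ..

theorem koszulD_algebraMap (r : R) : koszulD f (algebraMap R _ r) = 0 :=
  CliffordAlgebra.contractLeft_algebraMap ..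

theorem koszulD_koszulD (x : ExteriorAlgebra R V) : koszulD f (koszulD f x) = 0 :=
  CliffordAlgebra.contractLeft_contractLeft ..

theorem ι_mul_mem_exteriorPower (v : V) {k : ℕ} {x : ExteriorAlgebra R V} (hx : x ∈ ⋀[R]^k V) :
    ι R v * x ∈ ⋀[R]^(k + 1) V := by
  rw [exteriorPower, pow_succ']
  exact Submodule.mul_mem_mul (LinearMap.mem_range_self _ _) hx

theorem koszulD_mem_exteriorPower {k : ℕ} {x : ExteriorAlgebra R V}
    (hx : x ∈ ⋀[R]^(k + 1) V) : koszulD f x ∈ ⋀[R]^k V := by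
  induction k generalizing x with
  | zero =>
    rw [zero_add, exteriorPower, pow_one] at hx
    obtain ⟨v, rfl⟩ := hx
    rw [koszulD_ι, exteriorPower, pow_zero]
    exact Submodule.mem_one.2 ⟨_, rfl⟩
  | succ k ih =>
    rw [exteriorPower, pow_succ'] at hx
    induction hx using Submodule.mul_induction_on' with
    | mem_mul_mem v hv y hy =>
      obtain ⟨v, rfl⟩ := hv
      rw [koszulD_ι_mul]
      exact sub_mem (Submodule.smul_mem _ _ hy) (ι_mul_mem_exteriorPower v (ih hy))
    | add y _ z _ hy hz => rw [map_add]; exact add_mem hy hz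

/-- The cycles of degree `k` of the Koszul complex. -/
noncomputable def koszulCycles (k : ℕ) : Submodule R (ExteriorAlgebra R V) :=
  ⋀[R]^k V ⊓ (koszulD f).ker

/-- The boundaries of degree `k` of the Koszul complex. -/
noncomputable def koszulBoundaries (k : ℕ) : Submodule R (ExteriorAlgebra R V) :=
  (⋀[R]^(k + 1) V).map (koszulD f)

theorem koszulCycles_le_exteriorPower (k : ℕ) : koszulCycles f k ≤ ⋀[R]^k V :=
  inf_le_left

theorem koszulBoundaries_le_koszulCycles (k : ℕ) : koszulBoundaries f k ≤ koszulCycles f k := by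
  rintro _ ⟨x, hx, rfl⟩
  exact ⟨koszulD_mem_exteriorPower f hx, koszulD_koszulD f x⟩

theorem smul_mem_koszulBoundaries (v : V) {k : ℕ} {x : ExteriorAlgebra R V}
    (hx : x ∈ koszulCycles f k) : f v • x ∈ koszulBoundaries f k := by
  refine ⟨ι R v * x, ι_mul_mem_exteriorPower v hx.1, ?_⟩
  rw [koszulD_ι_mul, show koszulD f x = 0 from hx.2, mul_zero, sub_zero]

theorem koszulBoundaries_zero :
    koszulBoundaries f 0 = (LinearMap.range f).map (Algebra.linearMap R _) := by
  ext x
  simp only [koszulBoundaries, zero_add, exteriorPower, pow_one, Submodule.mem_map,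
    LinearMap.mem_range, exists_exists_eq_and, koszulD_ι, Algebra.linearMap_apply]

theorem exteriorPower_eq_bot [Nontrivial R] [Module.Free R V] [Module.Finite R V] {k : ℕ}
    (hk : Module.finrank R V < k) : ⋀[R]^k V = ⊥ := by
  have : Subsingleton (⋀[R]^k V) := by
    rw [← Module.finrank_eq_zero_iff_of_free (R := R), exteriorPower.finrank_eq,
      Nat.choose_eq_zero_of_lt hk]
  exact (Submodule.subsingleton_iff_eq_bot).1 this

theorem koszulBoundaries_eq_bot [Nontrivial R] [Module.Free R V] [Module.Finite R V] {k : ℕ}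
    (hk : Module.finrank R V ≤ k) : koszulBoundaries f k = ⊥ := by
  rw [koszulBoundaries, exteriorPower_eq_bot (Nat.lt_succ_of_le hk), Submodule.map_bot]

end ExteriorAlgebra

section TorFinite

variable (R : Type u) [CommRing R] (M : Type u) [AddCommGroup M] [Module R M]

/-- `Tor_k(N, M)` is a finitely generated module. -/
def TorFinite (k : ℕ) (N : Type u) [AddCommGroup N] [Module R N] : Prop :=
  Module.Finite R
    (((Tor (ModuleCat.{u} R) k).obj (ModuleCat.of R N)).obj (ModuleCat.of R M))

namespace TorFinite

variable {R M} {A B C : Type u} [AddCommGroup A] [AddCommGroup B] [AddCommGroup C]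
  [Module R A] [Module R B] [Module R C]

theorem of_equiv {k : ℕ} (e : A ≃ₗ[R] B) (h : TorFinite R M k A) : TorFinite R M k B :=
  (Module.Finite.equiv_iff (((Tor (ModuleCat.{u} R) k).mapIso e.toModuleIso).app
    (ModuleCat.of R M)).toLinearEquiv).1 h

theorem succ_of_flat [Module.Flat R A] (k : ℕ) : TorFinite R M (k + 1) A :=
  have := ModuleCat.subsingleton_tor_succ_of_flat (ModuleCat.of R M) (ModuleCat.of R A) k
  inferInstanceAs (Module.Finite R
    (((Tor (ModuleCat.{u} R) (k + 1)).obj (ModuleCat.of R A)).obj (ModuleCat.of R M)))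

theorem of_subsingleton [Subsingleton A] (k : ℕ) : TorFinite R M k A := by
  refine (ModuleCat.tor_finite_iff _ _ k).2 (ModuleCat.homology_finite_of_subsingleton _ k ?_)
  exact inferInstanceAs (Subsingleton (TensorProduct R A
    ((CategoryTheory.projectiveResolution (ModuleCat.of R M)).complex.X k)))

section Exact

variable {f : A →ₗ[R] B} {g : B →ₗ[R] C}

theorem middle [IsNoetherianRing R] (hf : Function.Injective f) (hg : Function.Surjective g)
    (he : Function.Exact f g) {k : ℕ} (hA : TorFinite R M k A) (hC : TorFinite R M k C) :
    TorFinite R M k B :=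
  ModuleCat.tor_finite_X₂ (ModuleCat.of R M)
    (ModuleCat.shortComplex_shortExact
      (ModuleCat.shortComplexOfCompEqZero f g he.linearMap_comp_eq_zero) he hf hg) k hA hC

theorem right_succ [IsNoetherianRing R] (hf : Function.Injective f) (hg : Function.Surjective g)
    (he : Function.Exact f g) {k : ℕ} (hB : TorFinite R M (k + 1) B) (hA : TorFinite R M k A) :
    TorFinite R M (k + 1) C :=
  ModuleCat.tor_succ_finite_X₃ (ModuleCat.of R M)
    (ModuleCat.shortComplex_shortExact
      (ModuleCat.shortComplexOfCompEqZero f g he.linearMap_comp_eq_zero) he hf hg) k hB hA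

theorem right_zero (hf : Function.Injective f) (hg : Function.Surjective g)
    (he : Function.Exact f g) (hB : TorFinite R M 0 B) : TorFinite R M 0 C :=
  ModuleCat.tor_zero_finite_X₃ (ModuleCat.of R M)
    (ModuleCat.shortComplex_shortExact
      (ModuleCat.shortComplexOfCompEqZero f g he.linearMap_comp_eq_zero) he hf hg) hB

end Exact

variable [IsNoetherianRing R]

theorem finFun {k : ℕ} (h : TorFinite R M k A) (m : ℕ) : TorFinite R M k (Fin m → A) := by
  induction m with
  | zero => exact of_subsingleton k
  | succ m ih =>
    refine of_equiv (Fin.consLinearEquiv R (fun _ : Fin (m + 1) => A))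
      (middle (f := LinearMap.inl R A (Fin m → A)) (g := LinearMap.snd R A (Fin m → A))
        LinearMap.inl_injective LinearMap.snd_surjective ?_ h ih)
    exact Function.Exact.inl_snd

/-- Finiteness of `Tor_i(R/a, M)` for `i ≤ k` implies that of `Tor_k(N, M)` for every finitely
generated module `N` killed by `a`. -/
theorem of_isTorsionBySet {a : Ideal R} {k : ℕ} (h : ∀ i ≤ k, TorFinite R M i (R ⧸ a))
    (N : Type u) [AddCommGroup N] [Module R N] [Module.Finite R N]
    (hN : Module.IsTorsionBySet R N a) : TorFinite R M k N := by
  induction k generalizing N with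
  | zero =>
    let := hN.module
    have := hN.isScalarTower (S := R)
    have := Module.Finite.of_restrictScalars_finite R (R ⧸ a) N
    obtain ⟨m, p, hp⟩ := Module.Finite.exists_fin' (R ⧸ a) N
    let q := p.restrictScalars R
    exact right_zero (f := q.ker.subtype) (g := q) q.ker.injective_subtype hp
      (LinearMap.exact_subtype_ker_map q) (finFun (h 0 le_rfl) m)
  | succ k ih =>
    let := hN.module
    have := hN.isScalarTower (S := R)
    have := Module.Finite.of_restrictScalars_finite R (R ⧸ a) N
    obtain ⟨m, p, hp⟩ := Module.Finite.exists_fin' (R ⧸ a) N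
    let q := p.restrictScalars R
    have hq : Module.IsTorsionBySet R q.ker a := by
      rintro ⟨x, hx⟩ r
      refine Subtype.ext (funext fun i => ?_)
      change r.1 • x i = 0
      rw [Algebra.smul_def, Ideal.Quotient.algebraMap_eq, Ideal.Quotient.eq_zero_iff_mem.2 r.2,
        zero_mul]
    exact right_succ (f := q.ker.subtype) (g := q) q.ker.injective_subtype hp
      (LinearMap.exact_subtype_ker_map q) (finFun (h (k + 1) le_rfl) m)
      (ih (fun i hi => h i (by lia)) _ hq)

section Koszul

open ExteriorAlgebra

variable {V : Type u} [AddCommGroup V] [Module R V] (f : Module.Dual R V)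

/-- The Koszul homology is killed by the image of `f`, so that finiteness of `Tor_k` passes from
the boundaries to the cycles. -/
theorem on_koszulCycles {k j : ℕ} [Module.Finite R V]
    (h : ∀ i ≤ k, TorFinite R M i (R ⧸ LinearMap.range f))
    (hB : TorFinite R M k (koszulBoundaries f j)) : TorFinite R M k (koszulCycles f j) := by
  have hle := koszulBoundaries_le_koszulCycles f j
  have : Module.Finite R (koszulCycles f j) :=
    Module.Finite.of_injective (Submodule.inclusion (koszulCycles_le_exteriorPower f j))
      (Submodule.inclusion_injective _)
  refine middle (f := Submodule.inclusion hle)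
    (g := ((koszulBoundaries f j).submoduleOf (koszulCycles f j)).mkQ)
    (Submodule.inclusion_injective hle) (Submodule.mkQ_surjective _) ?_ hB
    (of_isTorsionBySet h _ ?_)
  · rw [LinearMap.exact_iff, Submodule.ker_mkQ, Submodule.range_inclusion]
    rfl
  · rintro x ⟨_, v, rfl⟩
    obtain ⟨x, rfl⟩ := Submodule.mkQ_surjective _ x
    exact (Submodule.Quotient.mk_eq_zero _).2 (smul_mem_koszulBoundaries f v x.2)

theorem on_koszulBoundaries [Module.Free R V] [Module.Finite R V] [Nontrivial R] {k j : ℕ}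
    (h : ∀ i < k, TorFinite R M i (R ⧸ LinearMap.range f)) (hj : Module.finrank R V ≤ k + j) :
    TorFinite R M k (koszulBoundaries f j) := by
  induction k generalizing j with
  | zero =>
    have := Submodule.subsingleton_iff_eq_bot.2 (koszulBoundaries_eq_bot f (by simpa using hj))
    exact of_subsingleton 0
  | succ k ih =>
    refine right_succ (f := Submodule.inclusion (koszulCycles_le_exteriorPower f (j + 1)))
      (g := (koszulD f).submoduleMap (⋀[R]^(j + 1) V)) (Submodule.inclusion_injective _)
      (LinearMap.submoduleMap_surjective _ _) ?_ (succ_of_flat k)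
      (on_koszulCycles f (fun i hi => h i (by lia))
        (ih (j := j + 1) (fun i hi => h i (by lia)) (by lia)))
    rw [LinearMap.exact_iff, Submodule.range_inclusion]
    ext x
    rw [LinearMap.mem_ker, ← Submodule.coe_eq_zero]
    exact ⟨fun h => ⟨x.2, h⟩, fun h => h.2⟩

theorem quotient_range_succ [Module.Free R V] [Module.Finite R V] [Nontrivial R] {k : ℕ}
    (hk : Module.finrank R V ≤ k) (h : ∀ i ≤ k, TorFinite R M i (R ⧸ LinearMap.range f)) :
    TorFinite R M (k + 1) (R ⧸ LinearMap.range f) := by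
  have hB := on_koszulBoundaries (j := 0) f (fun i hi => h i hi.le) hk
  rw [koszulBoundaries_zero] at hB
  refine right_succ (LinearMap.range f).injective_subtype (Submodule.mkQ_surjective _)
    (LinearMap.exact_subtype_mkQ _) (succ_of_flat k) (of_equiv (Submodule.equivMapOfInjective
      (Algebra.linearMap R (ExteriorAlgebra R V))
      (ExteriorAlgebra.algebraMap_leftInverse V).injective _).symm hB)

end Koszul

end TorFinite

end TorFinite

/-- If `a` is an ideal generated by `n` elements and `Tor_i(R/a, M)` is finitely generated
for every `0 ≤ i ≤ n`, then `Tor_i(R/a, M)` is finitely generated for every `i ≥ 0`. -/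
theorem tor_finite_of_tor_finite_up_to_ngens
    {R : Type u} [CommRing R] [IsNoetherianRing R] (a : Ideal R)
    (M : Type u) [AddCommGroup M] [Module R M]
    (n : ℕ) (s : Fin n → R) (hgen : Ideal.span (Set.range s) = a)
    (h : ∀ i : ℕ, i ≤ n → Module.Finite R
      (((Tor (ModuleCat.{u} R) i).obj (ModuleCat.of R (R ⧸ a))).obj (ModuleCat.of R M)))
    (i : ℕ) :
    Module.Finite R
      (((Tor (ModuleCat.{u} R) i).obj (ModuleCat.of R (R ⧸ a))).obj (ModuleCat.of R M)) := by
  rcases subsingleton_or_nontrivial R with hR | hR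
  · have := Module.subsingleton R
      (((Tor (ModuleCat.{u} R) i).obj (ModuleCat.of R (R ⧸ a))).obj (ModuleCat.of R M))
    infer_instance
  have hf : LinearMap.range (Fintype.linearCombination R s) = a := by
    rw [Fintype.range_linearCombination, ← hgen]
  subst hf
  induction i using Nat.strong_induction_on with
  | _ i ih =>
    by_cases hi : i ≤ n
    · exact h i hi
    · obtain ⟨k, rfl⟩ := Nat.exists_eq_add_of_lt (not_le.1 hi)
      exact TorFinite.quotient_range_succ (Fintype.linearCombination R s) (by simp)
        (fun j hj => ih j (by lia))
end
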